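/- Let f satisfy (H) be a regular nonlinearity (a_f = ∞) such that for some 0 ≤ ε < 1 one has liminf_{t→∞} f(t)^{1+ε/4} f''(t)/f'(t)² > 0, and let Ω ⊂ ℝⁿ be a smooth bounded domain with n ≤ 7. Then any sequence (u_m) of semistable solutions of (N_{λ_m}) satisfies sup_m ‖f(u_m)‖_{L^{2−ε/4}(Ω)} < ∞, and consequently the extremal solution u* of (N_λ) is bounded. -/

import Mathlib

open MeasureTheory Filter Topology Real Set

noncomputable section

/-- The Laplacian of a real-valued function on Euclidean space. -/
def lap {n : ℕ} (u : EuclideanSpace ℝ (Fin n) → ℝ) (x : EuclideanSpace ℝ (Fin n)) : ℝ :=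
  ∑ i : Fin n, iteratedFDeriv ℝ 2 u x ![EuclideanSpace.single i (1:ℝ), EuclideanSpace.single i (1:ℝ)]

/-- A bounded (smooth) domain. -/
def GoodDomain {n : ℕ} (Ω : Set (EuclideanSpace ℝ (Fin n))) : Prop :=
  IsOpen Ω ∧ Bornology.IsBounded Ω ∧ Ω.Nonempty

/-- The domain `[0, a_f)` of the nonlinearity. -/
def domf (a : EReal) : Set ℝ := {t : ℝ | 0 ≤ t ∧ (t : EReal) < a}

/-- The filter of `t → a_f⁻`. -/
def afFilter (a : EReal) : Filter ℝ :=
  if a = ⊤ then Filter.atTop else nhdsWithin a.toReal (Set.Iio a.toReal)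

/-- Hypothesis (H) on the nonlinearity `f : [0, a_f) → ℝ₊`. -/
structure HypH (a : EReal) (f : ℝ → ℝ) : Prop where
  a_pos : 0 < a
  smooth : ContDiffOn ℝ (⊤ : ℕ∞) f (domf a)
  mono : StrictMonoOn f (domf a)
  convex : ConvexOn ℝ (domf a) f
  f0_pos : 0 < f 0
  pos : ∀ t ∈ domf a, 0 < f t
  blowup : Filter.Tendsto f (afFilter a) Filter.atTop
  superlinear : a = ⊤ → Filter.Tendsto (fun t => f t / t) Filter.atTop Filter.atTop

/-- `τ₋ = liminf_{t → a_f} f f'' / (f')²`. -/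
def tauMinus (a : EReal) (f : ℝ → ℝ) : ℝ :=
  Filter.liminf (fun t => f t * deriv (deriv f) t / (deriv f t) ^ 2) (afFilter a)

/-- `τ₊ = limsup_{t → a_f} f f'' / (f')²`. -/
def tauPlus (a : EReal) (f : ℝ → ℝ) : ℝ :=
  Filter.limsup (fun t => f t * deriv (deriv f) t / (deriv f t) ^ 2) (afFilter a)

/-- `u` is a (smooth, `[0,a_f)`-valued) solution of `Δ²u = λ f(u)` in `Ω`,
`u = Δu = 0` on `∂Ω`. -/
def Solves {n : ℕ} (Ω : Set (EuclideanSpace ℝ (Fin n))) (a : EReal) (lam : ℝ)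
    (f : ℝ → ℝ) (u : EuclideanSpace ℝ (Fin n) → ℝ) : Prop :=
  ContDiff ℝ (⊤ : ℕ∞) u ∧ (∀ x ∈ Ω, 0 ≤ u x ∧ (u x : EReal) < a) ∧
  (∀ x ∈ Ω, lap (lap u) x = lam * f (u x)) ∧
  (∀ x ∈ frontier Ω, u x = 0) ∧ (∀ x ∈ frontier Ω, lap u x = 0)

/-- `u` is a semistable solution: the second variation is nonnegative over
test functions in `H² ∩ H¹₀` (modelled by smooth functions vanishing on `∂Ω`). -/
def Semistable {n : ℕ} (Ω : Set (EuclideanSpace ℝ (Fin n))) (lam : ℝ)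
    (f : ℝ → ℝ) (u : EuclideanSpace ℝ (Fin n) → ℝ) : Prop :=
  ∀ φ : EuclideanSpace ℝ (Fin n) → ℝ, ContDiff ℝ (⊤ : ℕ∞) φ → (∀ x ∈ frontier Ω, φ x = 0) →
    0 ≤ ∫ x in Ω, ((lap φ x) ^ 2 - lam * deriv f (u x) * (φ x) ^ 2)

/-- `u` satisfies the stability inequality
`√λ ∫ √(f'(u)) φ² ≤ ∫ |∇φ|²` for all `φ ∈ H¹₀(Ω)`
(modelled by smooth compactly supported test functions). -/
def StabIneq {n : ℕ} (Ω : Set (EuclideanSpace ℝ (Fin n))) (lam : ℝ)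
    (f : ℝ → ℝ) (u : EuclideanSpace ℝ (Fin n) → ℝ) : Prop :=
  ∀ φ : EuclideanSpace ℝ (Fin n) → ℝ, ContDiff ℝ (⊤ : ℕ∞) φ → HasCompactSupport φ →
    tsupport φ ⊆ Ω →
    Real.sqrt lam * ∫ x in Ω, Real.sqrt (deriv f (u x)) * (φ x) ^ 2 ≤
      ∫ x in Ω, ‖gradient φ x‖ ^ 2

/-- The quartic polynomial `P_f(α, τ₋, τ₊)`. -/
def Pf (τm τp α : ℝ) : ℝ :=
  (2 - τm) ^ 2 * α ^ 4 - 8 * (2 - τp) * α ^ 2 + 4 * (4 - 3 * τp) * α - 4 * (1 - τp)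

/-- `F(t) = ∫₀ᵗ f(s) ds`. -/
def Fint (f : ℝ → ℝ) (t : ℝ) : ℝ := ∫ s in (0:ℝ)..t, f s

/-- `f̃(t) = f(t) - f(0)`. -/
def ftil (f : ℝ → ℝ) (t : ℝ) : ℝ := f t - f 0

/-- `Θ(t) = ∫₀ᵗ θ'(s)² ds`. -/
def Theta (θ : ℝ → ℝ) (t : ℝ) : ℝ := ∫ s in (0:ℝ)..t, (deriv θ s) ^ 2

/-! ### Laplacian basics -/

lemma lap_eq_sum {n : ℕ} (u : EuclideanSpace ℝ (Fin n) → ℝ) (hu : ContDiff ℝ 2 u)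
    (x : EuclideanSpace ℝ (Fin n)) :
    lap u x = ∑ i : Fin n, fderiv ℝ (fun y => fderiv ℝ u y (EuclideanSpace.single i (1:ℝ))) x
      (EuclideanSpace.single i (1:ℝ)) := by
  unfold lap
  refine Finset.sum_congr rfl fun i _ => ?_
  rw [iteratedFDeriv_two_apply]
  have h1 : DifferentiableAt ℝ (fderiv ℝ u) x :=
    ((hu.fderiv_right (m := 1) (by norm_num)).differentiable (by norm_num)) x
  rw [fderiv_clm_apply h1 (differentiableAt_const _)]
  simp

lemma lap_congr {n : ℕ} {u w : EuclideanSpace ℝ (Fin n) → ℝ} {x : EuclideanSpace ℝ (Fin n)}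
    (h : u =ᶠ[𝓝 x] w) : lap u x = lap w x := by
  unfold lap
  rw [(h.iteratedFDeriv ℝ 2).self_of_nhds]

lemma lap_contDiff {n : ℕ} {u : EuclideanSpace ℝ (Fin n) → ℝ} (hu : ContDiff ℝ (⊤ : ℕ∞) u) :
    ContDiff ℝ (⊤ : ℕ∞) (lap u) := by
  have h2 : ContDiff ℝ 2 u := contDiff_infty.mp hu 2
  have : lap u = fun x => ∑ i : Fin n, fderiv ℝ (fun y => fderiv ℝ u y
      (EuclideanSpace.single i (1:ℝ))) x (EuclideanSpace.single i (1:ℝ)) :=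
    funext (lap_eq_sum u h2)
  rw [this]
  refine ContDiff.sum fun i _ => ?_
  have h3 : ContDiff ℝ (⊤ : ℕ∞) (fun y => fderiv ℝ u y (EuclideanSpace.single i (1:ℝ))) :=
    (hu.fderiv_right (m := (⊤ : ℕ∞)) (by exact_mod_cast le_top)).clm_apply contDiff_const
  exact (h3.fderiv_right (m := (⊤ : ℕ∞)) (by exact_mod_cast le_top)).clm_apply contDiff_const

lemma lap_linear {n : ℕ} {u w : EuclideanSpace ℝ (Fin n) → ℝ} (hu : ContDiff ℝ 2 u)
    (hw : ContDiff ℝ 2 w) (a b : ℝ) (x : EuclideanSpace ℝ (Fin n)) :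
    lap (fun y => a * u y + b * w y) x = a * lap u x + b * lap w x := by
  rw [lap_eq_sum _ ((contDiff_const.mul hu).add (contDiff_const.mul hw)), lap_eq_sum u hu,
    lap_eq_sum w hw, Finset.mul_sum, Finset.mul_sum, ← Finset.sum_add_distrib]
  refine Finset.sum_congr rfl fun i _ => ?_
  have hdu : Differentiable ℝ u := hu.differentiable (by norm_num)
  have hdw : Differentiable ℝ w := hw.differentiable (by norm_num)
  have e1 : ∀ y, fderiv ℝ (fun y => a * u y + b * w y) y (EuclideanSpace.single i (1:ℝ)) =
      a * fderiv ℝ u y (EuclideanSpace.single i (1:ℝ)) +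
      b * fderiv ℝ w y (EuclideanSpace.single i (1:ℝ)) := by
    intro y
    rw [fderiv_fun_add ((hdu y).const_mul a) ((hdw y).const_mul b), fderiv_const_mul (hdu y),
      fderiv_const_mul (hdw y)]
    simp
  have d1 : Differentiable ℝ (fun y => fderiv ℝ u y (EuclideanSpace.single i (1:ℝ))) :=
    ((hu.fderiv_right (m := 1) (by norm_num)).clm_apply contDiff_const).differentiable
      (by norm_num)
  have d2 : Differentiable ℝ (fun y => fderiv ℝ w y (EuclideanSpace.single i (1:ℝ))) :=
    ((hw.fderiv_right (m := 1) (by norm_num)).clm_apply contDiff_const).differentiable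
      (by norm_num)
  simp_rw [e1]
  rw [fderiv_fun_add ((d1 x).const_mul a) ((d2 x).const_mul b), fderiv_const_mul (d1 x),
      fderiv_const_mul (d2 x)]
  simp

lemma lap_comp {n : ℕ} {q : EuclideanSpace ℝ (Fin n) → ℝ} (hq : ContDiff ℝ 2 q)
    {h h1 : ℝ → ℝ} {h2 : ℝ} {x : EuclideanSpace ℝ (Fin n)}
    (hc : ContDiff ℝ 2 (fun y => h (q y)))
    (hh : ∀ᶠ t in 𝓝 (q x), HasDerivAt h (h1 t) t) (hh2 : HasDerivAt h1 h2 (q x)) :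
    lap (fun y => h (q y)) x = h1 (q x) * lap q x +
      h2 * ∑ i : Fin n, (fderiv ℝ q x (EuclideanSpace.single i (1:ℝ))) ^ 2 := by
  rw [lap_eq_sum _ hc, lap_eq_sum q hq, Finset.mul_sum, Finset.mul_sum,
    ← Finset.sum_add_distrib]
  refine Finset.sum_congr rfl fun i _ => ?_
  have hdq : Differentiable ℝ q := hq.differentiable (by norm_num)
  have d1 : Differentiable ℝ (fun y => fderiv ℝ q y (EuclideanSpace.single i (1:ℝ))) :=
    ((hq.fderiv_right (m := 1) (by norm_num)).clm_apply contDiff_const).differentiable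
      (by norm_num)
  have hev : ∀ᶠ y in 𝓝 x, HasDerivAt h (h1 (q y)) (q y) :=
    (hdq x).continuousAt.eventually hh
  have e1 : (fun y => fderiv ℝ (fun y => h (q y)) y (EuclideanSpace.single i (1:ℝ))) =ᶠ[𝓝 x]
      fun y => h1 (q y) * fderiv ℝ q y (EuclideanSpace.single i (1:ℝ)) := by
    filter_upwards [hev] with y hy
    have := (hy.comp_hasFDerivAt y (hdq y).hasFDerivAt).fderiv
    have h' : fderiv ℝ (fun y => h (q y)) y = h1 (q y) • fderiv ℝ q y := this
    rw [h']; simp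
  rw [e1.fderiv_eq]
  have hx : HasFDerivAt (fun y => h1 (q y)) (h2 • fderiv ℝ q x) x :=
    hh2.comp_hasFDerivAt x (hdq x).hasFDerivAt
  rw [fderiv_fun_mul hx.differentiableAt (d1 x), hx.fderiv]
  simp
  ring

lemma second_deriv_nonneg {g : ℝ → ℝ} (hg : ContDiff ℝ 2 g) (x : ℝ) (h : IsLocalMin g x) :
    0 ≤ deriv (deriv g) x := by
  by_contra hneg
  push Not at hneg
  have hmax := isLocalMax_of_deriv_deriv_neg hneg h.deriv_eq_zero hg.continuous.continuousAt
  have hc : g =ᶠ[𝓝 x] fun _ => g x := by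
    filter_upwards [h, hmax] with y h1 h2 using le_antisymm h2 h1
  have h1 : deriv g =ᶠ[𝓝 x] fun _ => 0 := by
    have := hc.deriv
    simpa using this
  have := h1.deriv_eq
  simp at this
  linarith

lemma lap_nonneg_of_isLocalMin {n : ℕ} {u : EuclideanSpace ℝ (Fin n) → ℝ} (hu : ContDiff ℝ 2 u)
    {x : EuclideanSpace ℝ (Fin n)} (h : IsLocalMin u x) : 0 ≤ lap u x := by
  rw [lap_eq_sum u hu]
  refine Finset.sum_nonneg fun i _ => ?_
  set e : EuclideanSpace ℝ (Fin n) := EuclideanSpace.single i (1:ℝ)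
  have hL : ∀ t : ℝ, HasDerivAt (fun t : ℝ => x + t • e) e t := by
    intro t
    have := ((hasDerivAt_id t).smul_const e).const_add x
    simpa using this
  have hgc : ContDiff ℝ 2 (fun t : ℝ => u (x + t • e)) := by fun_prop
  have hdu : Differentiable ℝ u := hu.differentiable (by norm_num)
  have d1 : Differentiable ℝ (fun y => fderiv ℝ u y e) :=
    ((hu.fderiv_right (m := 1) (by norm_num)).clm_apply contDiff_const).differentiable
      (by norm_num)
  have e1 : deriv (fun t : ℝ => u (x + t • e)) = fun t => fderiv ℝ u (x + t • e) e := by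
    funext t
    exact ((hdu _).hasFDerivAt.comp_hasDerivAt t (hL t)).deriv
  have e2 : deriv (deriv (fun t : ℝ => u (x + t • e))) 0 =
      fderiv ℝ (fun y => fderiv ℝ u y e) x e := by
    rw [e1]
    have := ((d1 (x + (0:ℝ) • e)).hasFDerivAt.comp_hasDerivAt (0:ℝ) (hL 0)).deriv
    simpa [Function.comp_def] using this
  rw [← e2]
  apply second_deriv_nonneg hgc
  have hcont : ContinuousAt (fun t : ℝ => x + t • e) 0 := (hL 0).continuousAt
  have h' : ∀ᶠ y in 𝓝 ((fun t : ℝ => x + t • e) 0), u x ≤ u y := by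
    simp only [zero_smul, add_zero]; exact h
  have h3 := hcont.eventually h'
  unfold IsLocalMin IsMinFilter
  simpa using h3

/-- Weak minimum principle: if `w` is nonnegative on the frontier and `lap w < 0` wherever
`w` attains a nonpositive minimum. -/
lemma min_principle {n : ℕ} {Ω : Set (EuclideanSpace ℝ (Fin n))} (hΩ : GoodDomain Ω)
    {w : EuclideanSpace ℝ (Fin n) → ℝ} (hw : ContinuousOn w (closure Ω))
    (hb : ∀ x ∈ frontier Ω, 0 ≤ w x) {x0 : EuclideanSpace ℝ (Fin n)} (hx0 : x0 ∈ Ω)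
    (hneg : w x0 < 0) : ∃ x1 ∈ Ω, w x1 < 0 ∧ ∀ y ∈ Ω, w x1 ≤ w y := by
  obtain ⟨hO, hB, hN⟩ := hΩ
  have hcomp : IsCompact (closure Ω) := hB.isCompact_closure
  obtain ⟨x1, hx1, hmin⟩ := hcomp.exists_isMinOn ⟨x0, subset_closure hx0⟩ hw
  have h1 : w x1 ≤ w x0 := hmin (subset_closure hx0)
  have h2 : x1 ∈ Ω := by
    by_contra hcon
    have : x1 ∈ frontier Ω := by
      rw [hO.frontier_eq]; exact ⟨hx1, hcon⟩
    have := hb x1 this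
    linarith
  exact ⟨x1, h2, by linarith, fun y hy => hmin (subset_closure hy)⟩

/-! ### Calculus of the nonlinearity -/

lemma mem_domf_top {t : ℝ} : t ∈ domf ⊤ ↔ 0 ≤ t := by
  simp [domf]

lemma domf_top : domf ⊤ = Ici (0:ℝ) := by
  ext t; exact mem_domf_top

section calculus

variable {f : ℝ → ℝ}

lemma f_contAt (hf : HypH ⊤ f) {t : ℝ} (ht : 0 < t) : ContDiffAt ℝ (⊤ : ℕ∞) f t := by
  have h := hf.smooth
  rw [domf_top] at h
  exact h.contDiffAt (Ici_mem_nhds ht)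

lemma f_hasDeriv (hf : HypH ⊤ f) {t : ℝ} (ht : 0 < t) : HasDerivAt f (deriv f t) t :=
  ((f_contAt hf ht).differentiableAt (by simp)).hasDerivAt

lemma f_hasDeriv2 (hf : HypH ⊤ f) {t : ℝ} (ht : 0 < t) :
    HasDerivAt (deriv f) (deriv (deriv f) t) t := by
  have h2 : ContDiffOn ℝ 2 f (Ioi 0) := fun x hx =>
    ((contDiffAt_infty.mp (f_contAt hf hx)) 2).contDiffWithinAt
  have h1 : ContDiffOn ℝ 1 (deriv f) (Ioi 0) :=
    ((contDiffOn_succ_iff_deriv_of_isOpen (n := 1) isOpen_Ioi).mp (by norm_num; exact h2)).2.2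
  exact ((h1.contDiffAt (Ioi_mem_nhds ht)).differentiableAt (by norm_num)).hasDerivAt

lemma f_cont (hf : HypH ⊤ f) : ContinuousOn f (Ici 0) := by
  have h := hf.smooth.continuousOn
  rwa [domf_top] at h

lemma f_convex (hf : HypH ⊤ f) : ConvexOn ℝ (Ici 0) f := by
  have h := hf.convex
  rwa [domf_top] at h

lemma f_mono (hf : HypH ⊤ f) : StrictMonoOn f (Ici 0) := by
  have h := hf.mono
  rwa [domf_top] at h

lemma f_pos (hf : HypH ⊤ f) {t : ℝ} (ht : 0 ≤ t) : 0 < f t := hf.pos t (mem_domf_top.mpr ht)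

lemma df_mono (hf : HypH ⊤ f) : MonotoneOn (deriv f) (Ioi 0) :=
  ((f_convex hf).subset Ioi_subset_Ici_self (convex_Ioi 0)).monotoneOn_deriv
    fun _ hx => (f_hasDeriv hf hx).differentiableAt

lemma df_pos (hf : HypH ⊤ f) {t : ℝ} (ht : 0 < t) : 0 < deriv f t := by
  have h := (f_convex hf).slope_le_deriv (x := 0) (y := t) self_mem_Ici ht.le ht
    (f_hasDeriv hf ht).differentiableAt
  have h2 : f 0 < f t := f_mono hf self_mem_Ici ht.le ht
  refine lt_of_lt_of_le ?_ h
  rw [slope_def_field]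
  exact div_pos (by linarith) (by linarith)

lemma ddf_nonneg (hf : HypH ⊤ f) {t : ℝ} (ht : 0 < t) : 0 ≤ deriv (deriv f) t := by
  have h1 := (f_hasDeriv2 hf ht).hasDerivWithinAt (s := Ioi 0)
  have := (df_mono hf).derivWithin_nonneg (x := t)
  rwa [h1.derivWithin (isOpen_Ioi.uniqueDiffWithinAt ht)] at this

/-- `∫₀ᵗ (f - f(0))`. -/
def Ft (f : ℝ → ℝ) (t : ℝ) : ℝ := ∫ s in (0:ℝ)..t, (f s - f 0)

lemma ft_cont (hf : HypH ⊤ f) : ContinuousOn (fun s => f s - f 0) (Ici 0) :=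
  (f_cont hf).sub continuousOn_const

lemma ft_pos (hf : HypH ⊤ f) {t : ℝ} (ht : 0 < t) : 0 < f t - f 0 := by
  have h2 : f 0 < f t := f_mono hf self_mem_Ici ht.le ht
  linarith

lemma ft_int (hf : HypH ⊤ f) {t : ℝ} (ht : 0 ≤ t) :
    IntervalIntegrable (fun s => f s - f 0) volume 0 t := by
  apply ((ft_cont hf).mono _).intervalIntegrable
  rw [uIcc_of_le ht]
  exact Icc_subset_Ici_self

lemma Ft_hasDeriv (hf : HypH ⊤ f) {t : ℝ} (ht : 0 < t) :
    HasDerivAt (Ft f) (f t - f 0) t := by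
  apply intervalIntegral.integral_hasDerivAt_right (ft_int hf ht.le)
  · exact (((ft_cont hf).mono Ioi_subset_Ici_self).stronglyMeasurableAtFilter isOpen_Ioi) t ht
  · exact (ft_cont hf).continuousAt (Ici_mem_nhds ht)

lemma Ft_zero : Ft f 0 = 0 := by simp [Ft]

lemma Ft_contOn (hf : HypH ⊤ f) : ContinuousOn (Ft f) (Ici 0) := by
  intro t ht
  have ht' : (0:ℝ) ≤ t := ht
  have h1 : IntegrableOn (fun s => f s - f 0) (uIcc 0 (t+1)) volume := by
    rw [uIcc_of_le (by linarith)]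
    exact ((ft_cont hf).mono Icc_subset_Ici_self).integrableOn_Icc
  have h := intervalIntegral.continuousOn_primitive_interval h1
  rw [uIcc_of_le (by linarith)] at h
  refine (h t ⟨ht', by linarith⟩).mono_of_mem_nhdsWithin ?_
  rw [← Ici_inter_Iic]
  exact Filter.inter_mem self_mem_nhdsWithin (mem_nhdsWithin_of_mem_nhds (Iic_mem_nhds (by linarith)))

lemma Ft_pos (hf : HypH ⊤ f) {t : ℝ} (ht : 0 < t) : 0 < Ft f t := by
  have : StrictMonoOn (Ft f) (Ici 0) := by
    apply strictMonoOn_of_deriv_pos (convex_Ici 0) (Ft_contOn hf)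
    intro x hx
    rw [interior_Ici] at hx
    rw [(Ft_hasDeriv hf hx).deriv]
    exact ft_pos hf hx
  have := this self_mem_Ici ht.le ht
  rwa [Ft_zero] at this

/-- `G = 2 f' F̃ - f̃² ≥ 0`. -/
lemma G_nonneg (hf : HypH ⊤ f) {t : ℝ} (ht : 0 < t) :
    (f t - f 0) ^ 2 ≤ 2 * deriv f t * Ft f t := by
  have hm : MonotoneOn (fun s => 2 * deriv f t * Ft f s - (f s - f 0) ^ 2) (Icc 0 t) := by
    apply monotoneOn_of_hasDerivWithinAt_nonneg (convex_Icc 0 t)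
      (f' := fun s => 2 * deriv f t * (f s - f 0) - 2 * (f s - f 0) * deriv f s)
    · exact (continuousOn_const.mul ((Ft_contOn hf).mono Icc_subset_Ici_self)).sub
        (((ft_cont hf).mono Icc_subset_Ici_self).pow 2)
    · intro s hs
      rw [interior_Icc] at hs
      have h := ((Ft_hasDeriv hf hs.1).const_mul (2 * deriv f t)).sub
        (((f_hasDeriv hf hs.1).sub_const (f 0)).pow 2)
      exact (h.congr_deriv (by norm_num)).hasDerivWithinAt
    · intro s hs
      rw [interior_Icc] at hs
      have h1 := df_mono hf hs.1 ht hs.2.le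
      have h2 := ft_pos hf hs.1
      nlinarith
  have := hm (left_mem_Icc.mpr ht.le) (right_mem_Icc.mpr ht.le) ht.le
  simp [Ft_zero] at this
  linarith

lemma G_hasDeriv (hf : HypH ⊤ f) {t : ℝ} (ht : 0 < t) :
    HasDerivAt (fun s => 2 * deriv f s * Ft f s - (f s - f 0) ^ 2)
      (2 * deriv (deriv f) t * Ft f t) t := by
  have h := (((f_hasDeriv2 hf ht).const_mul 2).mul (Ft_hasDeriv hf ht)).sub
        (((f_hasDeriv hf ht).sub_const (f 0)).pow 2)
  exact h.congr_deriv (by norm_num; ring)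

/-- convexity of `√(2F̃)`. -/
lemma sqrt_convex (hf : HypH ⊤ f) : ConvexOn ℝ (Ici 0) (fun t => √(2 * Ft f t)) := by
  apply convexOn_of_hasDerivWithinAt2_nonneg (convex_Ici 0)
    (f' := fun t => (f t - f 0) / √(2 * Ft f t))
    (f'' := fun t => (deriv f t * √(2 * Ft f t) - (f t - f 0) * ((f t - f 0) / √(2 * Ft f t)))
      / (√(2 * Ft f t)) ^ 2)
  · exact (continuousOn_const.mul (Ft_contOn hf)).sqrt
  · intro t ht
    rw [interior_Ici] at ht
    have hp := Ft_pos hf ht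
    have h := ((Ft_hasDeriv hf ht).const_mul 2).sqrt (by positivity)
    exact (h.congr_deriv (by field_simp)).hasDerivWithinAt
  · intro t ht
    rw [interior_Ici] at ht
    have hp := Ft_pos hf ht
    have h := ((Ft_hasDeriv hf ht).const_mul 2).sqrt (by positivity)
    have hs : 0 < √(2 * Ft f t) := by positivity
    have h2 := ((f_hasDeriv hf ht).sub_const (f 0)).div h hs.ne'
    exact (h2.congr_deriv (by field_simp)).hasDerivWithinAt
  · intro t ht
    rw [interior_Ici] at ht
    have hp := Ft_pos hf ht
    have hs : 0 < √(2 * Ft f t) := by positivity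
    apply div_nonneg _ (by positivity)
    rw [sub_nonneg, mul_div_assoc', div_le_iff₀ hs, mul_assoc, Real.mul_self_sqrt (by positivity)]
    have := G_nonneg hf ht
    nlinarith

lemma sqrt_tangent (hf : HypH ⊤ f) {t t1 : ℝ} (ht : 0 ≤ t) (ht1 : 0 < t1) :
    √(2 * Ft f t1) + (f t1 - f 0) / √(2 * Ft f t1) * (t - t1) ≤ √(2 * Ft f t) := by
  have hp := Ft_pos hf ht1
  have h : HasDerivAt (fun t => √(2 * Ft f t)) ((f t1 - f 0) / √(2 * Ft f t1)) t1 := by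
    have h := ((Ft_hasDeriv hf ht1).const_mul 2).sqrt (by positivity)
    exact h.congr_deriv (by field_simp)
  rcases lt_trichotomy t t1 with hlt | heq | hgt
  · have := (sqrt_convex hf).slope_le_deriv (x := t) (y := t1) ht ht1.le hlt h.differentiableAt
    rw [h.deriv, slope_def_field, div_le_iff₀ (by linarith)] at this
    linarith
  · subst heq; simp
  · have := (sqrt_convex hf).deriv_le_slope (x := t1) (y := t) ht1.le ht hgt h.differentiableAt
    rw [h.deriv, slope_def_field, le_div_iff₀ (by linarith)] at this
    linarith

/-- Key pointwise growth estimate. -/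
lemma key_growth (hf : HypH ⊤ f) {ε : ℝ} (hε1 : ε < 1)
    (hliminf : 0 < Filter.liminf
      (fun t => f t ^ (1 + ε / 4) * deriv (deriv f) t / (deriv f t) ^ 2) Filter.atTop) :
    ∃ c C : ℝ, 0 < c ∧ 0 ≤ C ∧ ∀ t, 0 < t →
      c * f t ^ (2 - ε / 4) - C ≤ 2 * deriv f t * Ft f t - f t ^ 2 := by
  obtain ⟨c0, hc0, hc0l⟩ := exists_between hliminf
  have hbd : Filter.atTop.IsBoundedUnder (· ≥ ·)
      (fun t => f t ^ (1 + ε / 4) * deriv (deriv f) t / (deriv f t) ^ 2) := by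
    refine ⟨0, ?_⟩
    rw [eventually_map]
    filter_upwards [eventually_gt_atTop 0] with t ht
    have h1 := ddf_nonneg hf ht
    have h2 := f_pos hf ht.le
    positivity
  have hev := Filter.eventually_lt_of_lt_liminf hc0l hbd
  have hblow : Tendsto f atTop atTop := by
    have := hf.blowup
    simpa [afFilter] using this
  have hev2 : ∀ᶠ t in atTop, 2 * f 0 ≤ f t := hblow.eventually_ge_atTop _
  obtain ⟨T0, hT0⟩ := eventually_atTop.mp (hev.and hev2)
  set T := max T0 1
  have hTpos : 0 < T := lt_of_lt_of_le one_pos (le_max_right _ _)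
  set p : ℝ := 2 - ε / 4 with hpdef
  have hp1 : 1 < p := by simp only [hpdef]; linarith
  have hp0 : 0 < p := by linarith
  set c1 : ℝ := c0 / (4 * p) with hc1
  have hc1pos : 0 < c1 := by positivity
  have hmono : MonotoneOn (fun s => (2 * deriv f s * Ft f s - (f s - f 0) ^ 2) - c1 * f s ^ p)
      (Ici T) := by
    have hder : ∀ s, T ≤ s → HasDerivAt
        (fun s => (2 * deriv f s * Ft f s - (f s - f 0) ^ 2) - c1 * f s ^ p)
        (2 * deriv (deriv f) s * Ft f s - c1 * (deriv f s * p * f s ^ (p - 1))) s := by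
      intro s hs
      have hs0 : 0 < s := by linarith
      exact (G_hasDeriv hf hs0).sub
        (((f_hasDeriv hf hs0).rpow_const (Or.inl (f_pos hf hs0.le).ne')).const_mul c1)
    apply monotoneOn_of_hasDerivWithinAt_nonneg (convex_Ici T)
      (f' := fun s => 2 * deriv (deriv f) s * Ft f s - c1 * (deriv f s * p * f s ^ (p - 1)))
    · exact fun s hs => (hder s hs).continuousAt.continuousWithinAt
    · intro s hs
      rw [interior_Ici] at hs
      exact (hder s (le_of_lt hs)).hasDerivWithinAt
    · intro s hs
      rw [interior_Ici] at hs
      have hs' : T < s := hs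
      have hs0 : 0 < s := by linarith
      obtain ⟨h1, h2⟩ := hT0 s ((le_max_left _ _).trans hs'.le)
      have hd := df_pos hf hs0
      have hfp := f_pos hf hs0.le
      rw [lt_div_iff₀ (by positivity)] at h1
      have hG := G_nonneg hf hs0
      have hFp := Ft_pos hf hs0
      have hA : 0 < f s ^ (1 + ε / 4) := by positivity
      have hsplit : f s ^ (p - 1) * f s ^ (1 + ε / 4) = f s ^ 2 := by
        rw [← Real.rpow_add hfp, ← Real.rpow_natCast]
        congr 1
        simp only [hpdef]; push_cast; ring
      have h3 : f s ^ 2 / 4 ≤ (f s - f 0) ^ 2 := by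
        have : f s / 2 ≤ f s - f 0 := by linarith
        nlinarith
      have h4 : c1 * p = c0 / 4 := by rw [hc1]; field_simp
      have h5 : f s ^ (1 + ε / 4) * (c1 * (deriv f s * p * f s ^ (p - 1))) ≤
          f s ^ (1 + ε / 4) * (2 * deriv (deriv f) s * Ft f s) := by
        calc f s ^ (1 + ε / 4) * (c1 * (deriv f s * p * f s ^ (p - 1)))
            = (c1 * p) * deriv f s * (f s ^ (p - 1) * f s ^ (1 + ε / 4)) := by ring
          _ = c0 * deriv f s * (f s ^ 2 / 4) := by rw [h4, hsplit]; ring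
          _ ≤ c0 * deriv f s * (2 * deriv f s * Ft f s) := by
              apply mul_le_mul_of_nonneg_left (h3.trans hG) (by positivity)
          _ = 2 * Ft f s * (c0 * deriv f s ^ 2) := by ring
          _ ≤ 2 * Ft f s * (f s ^ (1 + ε / 4) * deriv (deriv f) s) :=
              mul_le_mul_of_nonneg_left h1.le (by positivity)
          _ = _ := by ring
      have := le_of_mul_le_mul_left h5 hA
      linarith
  set B := c1 * f T ^ p with hB
  have hB0 : 0 ≤ B := by
    have := f_pos hf hTpos.le
    positivity
  have hGlow : ∀ t, 0 < t → c1 * f t ^ p - B ≤ 2 * deriv f t * Ft f t - (f t - f 0) ^ 2 := by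
    intro t ht
    rcases le_total t T with h | h
    · have h1 : f t ≤ f T := (f_mono hf).monotoneOn ht.le hTpos.le h
      have h2 : f t ^ p ≤ f T ^ p := Real.rpow_le_rpow (f_pos hf ht.le).le h1 hp0.le
      have h3 := G_nonneg hf ht
      have h4 := mul_le_mul_of_nonneg_left h2 hc1pos.le
      linarith
    · have h1 := hmono self_mem_Ici h h
      have h3 := G_nonneg hf hTpos
      linarith
  -- absorb `2 f(0) f`
  set K : ℝ := (4 * f 0 / c1) ^ (1 / (p - 1)) with hK
  have hf0 := hf.f0_pos
  have hK0 : 0 < K := by positivity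
  refine ⟨c1 / 2, B + 2 * f 0 * K, by positivity, by positivity, fun t ht => ?_⟩
  have h1 := hGlow t ht
  have hfp := f_pos hf ht.le
  have habs : 2 * f 0 * f t ≤ c1 / 2 * f t ^ p + 2 * f 0 * K := by
    rcases le_total (f t) K with h | h
    · have : 0 ≤ c1 / 2 * f t ^ p := by positivity
      have := mul_le_mul_of_nonneg_left h (by positivity : 0 ≤ 2 * f 0)
      linarith
    · have h2 : K ^ (p - 1) ≤ f t ^ (p - 1) := Real.rpow_le_rpow hK0.le h (by linarith)
      have h3 : K ^ (p - 1) = 4 * f 0 / c1 := by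
        rw [hK, ← Real.rpow_mul (by positivity), one_div_mul_cancel (by linarith), Real.rpow_one]
      rw [h3, div_le_iff₀ hc1pos] at h2
      have h4 : f t ^ p = f t ^ (p - 1) * f t := by
        rw [← Real.rpow_add_one hfp.ne']; congr 1; ring
      have h5 := mul_le_mul_of_nonneg_right h2 hfp.le
      have : 0 ≤ 2 * f 0 * K := by positivity
      rw [h4]
      nlinarith
  nlinarith

end calculus

/-! ### The `L^{2-ε/4}` estimate -/

lemma lap_neg' {n : ℕ} {u : EuclideanSpace ℝ (Fin n) → ℝ} (hu : ContDiff ℝ 2 u)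
    (x : EuclideanSpace ℝ (Fin n)) : lap (fun y => - u y) x = - lap u x := by
  have h := lap_linear hu hu (-1) 0 x
  simpa using h

section pde

variable {n : ℕ} {Ω : Set (EuclideanSpace ℝ (Fin n))} {f : ℝ → ℝ} {lam : ℝ}
  {u : EuclideanSpace ℝ (Fin n) → ℝ}

lemma sol_neg_lap_pos (hΩ : GoodDomain Ω) (hf : HypH ⊤ f) (hlam : 0 < lam)
    (hs : Solves Ω ⊤ lam f u) : ∀ x ∈ Ω, 0 < - lap u x := by
  obtain ⟨hu, hr, he, hb, hb2⟩ := hs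
  have hL := lap_contDiff hu
  have hL2 : ContDiff ℝ 2 (fun y => - lap u y) := (contDiff_infty.mp hL 2).neg
  have key : ∀ x1 ∈ Ω, ¬ (∀ y ∈ Ω, - lap u x1 ≤ - lap u y) := by
    intro x1 hx1 hmin
    have hloc : IsLocalMin (fun y => - lap u y) x1 := by
      filter_upwards [hΩ.1.mem_nhds hx1] with y hy using hmin y hy
    have h1 := lap_nonneg_of_isLocalMin hL2 hloc
    rw [lap_neg' (contDiff_infty.mp hL 2), he x1 hx1] at h1
    have h2 := f_pos hf (hr x1 hx1).1
    have := mul_pos hlam h2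
    linarith
  have hge : ∀ x ∈ Ω, 0 ≤ - lap u x := by
    intro x hx
    by_contra hneg
    push Not at hneg
    obtain ⟨x1, hx1, -, hmin⟩ := min_principle hΩ hL2.continuous.continuousOn
      (fun y hy => by simp [hb2 y hy]) hx hneg
    exact key x1 hx1 hmin
  intro x hx
  rcases (hge x hx).lt_or_eq with h | h
  · exact h
  · exact absurd (fun y hy => by rw [← h]; exact hge y hy) (key x hx)

lemma sol_pos (hΩ : GoodDomain Ω) (hf : HypH ⊤ f) (hlam : 0 < lam)
    (hs : Solves Ω ⊤ lam f u) : ∀ x ∈ Ω, 0 < u x := by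
  intro x hx
  have hv := sol_neg_lap_pos hΩ hf hlam hs x hx
  obtain ⟨hu, hr, he, hb, hb2⟩ := hs
  rcases (hr x hx).1.lt_or_eq with h | h
  · exact h
  · exfalso
    have hloc : IsLocalMin u x := by
      filter_upwards [hΩ.1.mem_nhds hx] with y hy
      rw [← h]; exact (hr y hy).1
    have := lap_nonneg_of_isLocalMin (contDiff_infty.mp hu 2) hloc
    linarith

lemma nonneg_closure (hΩ : GoodDomain Ω) {w : EuclideanSpace ℝ (Fin n) → ℝ}
    (h1 : ∀ x ∈ Ω, 0 ≤ w x) (h2 : ∀ x ∈ frontier Ω, w x = 0) : ∀ x ∈ closure Ω, 0 ≤ w x := by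
  intro x hx
  by_cases h : x ∈ Ω
  · exact h1 x h
  · rw [h2 x (by rw [hΩ.1.frontier_eq]; exact ⟨hx, h⟩)]

/-- pointwise comparison `-Δu ≥ √(2λ F̃(u))`. -/
lemma comparison (hΩ : GoodDomain Ω) (hf : HypH ⊤ f) (hlam : 0 < lam)
    (hs : Solves Ω ⊤ lam f u) : ∀ x ∈ Ω, √lam * √(2 * Ft f (u x)) ≤ - lap u x := by
  have hup := sol_pos hΩ hf hlam hs
  obtain ⟨hu, hr, he, hb, hb2⟩ := hs
  have hL := lap_contDiff hu
  have hL2 : ContDiff ℝ 2 (lap u) := contDiff_infty.mp hL 2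
  have hu2 : ContDiff ℝ 2 u := contDiff_infty.mp hu 2
  have hunn := nonneg_closure hΩ (fun x hx => (hr x hx).1) hb
  intro x hx
  by_contra hneg
  push Not at hneg
  have hcont : ContinuousOn (fun y => - lap u y - √lam * √(2 * Ft f (u y))) (closure Ω) := by
    apply hL.continuous.neg.continuousOn.sub
    apply continuousOn_const.mul
    apply ContinuousOn.sqrt
    apply continuousOn_const.mul
    exact (Ft_contOn hf).comp hu.continuous.continuousOn hunn
  obtain ⟨x1, hx1, hlt, hmin⟩ := min_principle hΩ hcont
    (fun y hy => by simp [hb2 y hy, hb y hy, Ft_zero]) hx (by linarith)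
  have ht1 := hup x1 hx1
  set t1 := u x1 with ht1def
  have hp := Ft_pos hf ht1
  have hsq : 0 < √(2 * Ft f t1) := by positivity
  have hsl : 0 < √lam := Real.sqrt_pos.mpr hlam
  set κ : ℝ := √lam * ((f t1 - f 0) / √(2 * Ft f t1)) with hκ
  have hκ0 : 0 < κ := mul_pos hsl (div_pos (ft_pos hf ht1) hsq)
  have hloc : IsLocalMin (fun y => (-1) * lap u y + (-κ) * u y) x1 := by
    filter_upwards [hΩ.1.mem_nhds hx1] with y hy
    have h1 := hmin y hy
    have h2 := sqrt_tangent hf (hr y hy).1 ht1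
    have h3 := mul_le_mul_of_nonneg_left h2 hsl.le
    have h4 : √lam * (√(2 * Ft f t1) + (f t1 - f 0) / √(2 * Ft f t1) * (u y - t1)) =
        √lam * √(2 * Ft f t1) + κ * (u y - t1) := by rw [hκ]; ring
    rw [h4] at h3
    rw [← ht1def]
    linarith
  have hfin := lap_nonneg_of_isLocalMin
    ((contDiff_const.mul hL2).add (contDiff_const.mul hu2)) hloc
  rw [lap_linear hL2 hu2, he x1 hx1, ← ht1def] at hfin
  have h5 : κ * (- lap u x1) < κ * (√lam * √(2 * Ft f t1)) :=
    mul_lt_mul_of_pos_left (by linarith) hκ0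
  have h6 : κ * (√lam * √(2 * Ft f t1)) = lam * (f t1 - f 0) := by
    rw [hκ]
    field_simp
    rw [Real.sq_sqrt hlam.le]
    ring
  have h7 := mul_pos hlam hf.f0_pos
  nlinarith

lemma u_bounded (hΩ : GoodDomain Ω) (hu : Continuous u) : ∃ M : ℝ, 0 < M ∧ ∀ x ∈ Ω, u x ≤ M := by
  obtain ⟨C, hC⟩ := (hΩ.2.1.isCompact_closure.image hu).bddAbove
  exact ⟨max C 1, lt_of_lt_of_le one_pos (le_max_right _ _), fun x hx =>
    (hC ⟨x, subset_closure hx, rfl⟩).trans (le_max_left _ _)⟩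

lemma vol_lt_top (hΩ : GoodDomain Ω) : volume Ω < ⊤ := hΩ.2.1.measure_lt_top

/-- bounded functions continuous on `Ω` are integrable -/
lemma int_of_bdd (hΩ : GoodDomain Ω) {w : EuclideanSpace ℝ (Fin n) → ℝ} (hw : ContinuousOn w Ω)
    (C : ℝ) (hC : ∀ x ∈ Ω, |w x| ≤ C) : IntegrableOn w Ω :=
  IntegrableOn.of_bound (C := C) (vol_lt_top hΩ)
    (hw.aestronglyMeasurable hΩ.1.measurableSet)
    ((ae_restrict_iff' hΩ.1.measurableSet).mpr (ae_of_all _ fun x hx => hC x hx))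

lemma lp_bound (hΩ : GoodDomain Ω) (hf : HypH ⊤ f) (hlam : 0 < lam)
    (hs : Solves Ω ⊤ lam f u) (hst : Semistable Ω lam f u) {c C p : ℝ} (hc : 0 < c) (hp : 0 < p)
    (hk : ∀ t, 0 < t → c * f t ^ p - C ≤ 2 * deriv f t * Ft f t - f t ^ 2) :
    IntegrableOn (fun x => f (u x) ^ p) Ω ∧
      ∫ x in Ω, f (u x) ^ p ≤ C / c * volume.real Ω := by
  have hup := sol_pos hΩ hf hlam hs
  have hcomp := comparison hΩ hf hlam hs
  obtain ⟨hu, hr, he, hb, hb2⟩ := hs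
  have hL := lap_contDiff hu
  obtain ⟨M, hM, hMu⟩ := u_bounded hΩ hu.continuous
  obtain ⟨V, hV, hVu⟩ := u_bounded hΩ (hL.continuous.pow 2)
  have hfu : ContinuousOn (fun x => f (u x)) Ω :=
    (f_cont hf).comp hu.continuous.continuousOn (fun x hx => (hr x hx).1)
  have hfM : ∀ x ∈ Ω, f (u x) ≤ f M := fun x hx =>
    (f_mono hf).monotoneOn (hr x hx).1 hM.le (hMu x hx)
  have hfp : ∀ x ∈ Ω, 0 < f (u x) := fun x hx => f_pos hf (hr x hx).1
  have hdfu : ContinuousOn (fun x => deriv f (u x)) Ω := by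
    have : ContinuousOn (deriv f) (Ioi 0) := fun t ht =>
      (f_hasDeriv2 hf ht).continuousAt.continuousWithinAt
    exact this.comp hu.continuous.continuousOn (fun x hx => hup x hx)
  have hdM : ∀ x ∈ Ω, deriv f (u x) ≤ deriv f M := fun x hx =>
    df_mono hf (hup x hx) hM (hMu x hx)
  have I1 : IntegrableOn (fun x => f (u x) ^ p) Ω := by
    apply int_of_bdd hΩ (hfu.rpow_const fun x hx => Or.inl (hfp x hx).ne') (f M ^ p)
    intro x hx
    rw [abs_of_nonneg (Real.rpow_nonneg (hfp x hx).le _)]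
    exact Real.rpow_le_rpow (hfp x hx).le (hfM x hx) hp.le
  refine ⟨I1, ?_⟩
  have I2 : IntegrableOn (fun x => f (u x) ^ 2) Ω := by
    apply int_of_bdd hΩ (hfu.pow 2) (f M ^ 2)
    intro x hx
    rw [Pi.pow_apply, abs_of_nonneg (sq_nonneg _)]
    exact pow_le_pow_left₀ (hfp x hx).le (hfM x hx) 2
  have I3 : IntegrableOn (fun x => deriv f (u x) * (lap u x) ^ 2) Ω := by
    apply int_of_bdd (w := fun x => deriv f (u x) * (lap u x) ^ 2) hΩ (hdfu.mul (hL.continuous.pow 2).continuousOn) (deriv f M * V)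
    intro x hx
    rw [abs_of_nonneg (mul_nonneg (df_pos hf (hup x hx)).le (sq_nonneg _))]
    exact mul_le_mul (hdM x hx) (hVu x hx) (sq_nonneg _) (df_pos hf hM).le
  have hstab := hst (fun y => - lap u y) hL.neg (fun x hx => by simp [hb2 x hx])
  have hL2 : ContDiff ℝ 2 (lap u) := contDiff_infty.mp hL 2
  -- the integrand is bounded by `lam² (C - c f^p)`
  have hle : ∫ x in Ω, ((lap (fun y => - lap u y) x) ^ 2 - lam * deriv f (u x) * (- lap u x) ^ 2)
      ≤ ∫ x in Ω, lam ^ 2 * (C - c * f (u x) ^ p) := by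
    apply setIntegral_mono_on _ _ hΩ.1.measurableSet
    · intro x hx
      rw [lap_neg' hL2, he x hx]
      have h1 := hk _ (hup x hx)
      have h2 := hcomp x hx
      have h3 : lam * (2 * Ft f (u x)) ≤ (- lap u x) ^ 2 := by
        have h4 := pow_le_pow_left₀ (by positivity) h2 2
        rwa [mul_pow, Real.sq_sqrt hlam.le, Real.sq_sqrt
          (by have := Ft_pos hf (hup x hx); positivity)] at h4
      have h5 : lam * deriv f (u x) * (lam * (2 * Ft f (u x))) ≤
          lam * deriv f (u x) * (- lap u x) ^ 2 :=
        mul_le_mul_of_nonneg_left h3 (mul_pos hlam (df_pos hf (hup x hx))).le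
      have h6 := mul_le_mul_of_nonneg_left h1 (sq_nonneg lam)
      nlinarith
    · have : IntegrableOn (fun x => lam ^ 2 * f (u x) ^ 2 -
          lam * (deriv f (u x) * (lap u x) ^ 2)) Ω :=
        (I2.const_mul _).sub (I3.const_mul _)
      refine this.congr_fun (fun x hx => ?_) hΩ.1.measurableSet
      simp only
      rw [lap_neg' hL2, he x hx]
      ring
    · exact ((integrableOn_const (vol_lt_top hΩ).ne).sub (I1.const_mul c)).const_mul _
  have h0 := hstab.trans hle
  have I4 : Integrable (fun _ => C) (volume.restrict Ω) := integrableOn_const (vol_lt_top hΩ).ne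
  rw [integral_const_mul, integral_sub I4 (I1.const_mul c),
    setIntegral_const, integral_const_mul, smul_eq_mul] at h0
  have h1 : 0 ≤ volume.real Ω * C - c * ∫ x in Ω, f (u x) ^ p :=
    nonneg_of_mul_nonneg_right h0 (by positivity)
  rw [div_mul_eq_mul_div, le_div_iff₀ hc]
  linarith

end pde

/-! ### Potential estimate -/

lemma exists_psi {η : ℝ} (hη : 0 < η) : ∃ ψ ψ1 ψ2 : ℝ → ℝ, ContDiff ℝ 2 ψ ∧
    (∀ t, HasDerivAt ψ (ψ1 t) t) ∧ (∀ t, HasDerivAt ψ1 (ψ2 t) t) ∧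
    (∀ t, 0 ≤ ψ1 t) ∧ (∀ t, ψ1 t ≤ 1) ∧ (∀ t, 0 ≤ ψ2 t) ∧ (∀ t ≤ η, ψ t = 0) ∧
    (∀ t, 0 ≤ ψ t) ∧ ∀ t, t - 2 * η ≤ ψ t := by
  set ψ1 : ℝ → ℝ := fun s => Real.smoothTransition (s / η - 1) with hψ1
  have h1c : ContDiff ℝ 1 ψ1 := by
    have h : ContDiff ℝ 1 Real.smoothTransition := Real.smoothTransition.contDiff (n := 1)
    exact h.comp ((contDiff_id.div_const η).sub contDiff_const)
  have hd : ∀ t, HasDerivAt (fun t => ∫ s in (0:ℝ)..t, ψ1 s) (ψ1 t) t := fun t =>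
    intervalIntegral.integral_hasDerivAt_right (h1c.continuous.intervalIntegrable _ _)
      (h1c.continuous.stronglyMeasurableAtFilter _ _) h1c.continuous.continuousAt
  have hmono : Monotone ψ1 := fun a b hab => Real.smoothTransition.monotone (by
    have : a / η ≤ b / η := by gcongr
    linarith)
  have h0 : ∀ t, 0 ≤ ψ1 t := fun t => Real.smoothTransition.nonneg _
  have hz : ∀ t ≤ η, (∫ s in (0:ℝ)..t, ψ1 s) = 0 := by
    intro t ht
    apply intervalIntegral.integral_zero_ae
    refine ae_of_all _ fun s hs => ?_
    have : s ≤ η := by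
      rcases le_total 0 t with h | h
      · rw [uIoc_of_le h] at hs; linarith [hs.2]
      · rw [uIoc_of_ge h] at hs; linarith [hs.2]
    apply Real.smoothTransition.zero_of_nonpos
    rw [sub_nonpos, div_le_one hη]; exact this
  have hmonoψ : Monotone (fun t => ∫ s in (0:ℝ)..t, ψ1 s) :=
    monotone_of_hasDerivAt_nonneg hd h0
  have hnn : ∀ t, 0 ≤ ∫ s in (0:ℝ)..t, ψ1 s := by
    intro t
    rcases le_total t η with h | h
    · rw [hz t h]
    · have := hmonoψ h
      simp only at this
      rwa [hz η le_rfl] at this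
  refine ⟨fun t => ∫ s in (0:ℝ)..t, ψ1 s, ψ1, deriv ψ1, ?_, hd, ?_, h0, ?_, ?_, hz, hnn, ?_⟩
  · rw [show (2 : WithTop ℕ∞) = 1 + 1 by norm_num, contDiff_succ_iff_deriv]
    refine ⟨fun t => (hd t).differentiableAt, by simp, ?_⟩
    have : deriv (fun t => ∫ s in (0:ℝ)..t, ψ1 s) = ψ1 := funext fun t => (hd t).deriv
    rwa [this]
  · exact fun t => (h1c.differentiable (by norm_num) t).hasDerivAt
  · exact fun t => Real.smoothTransition.le_one _
  · intro t
    exact hmono.deriv_nonneg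
  · intro t
    rcases le_total t (2 * η) with h | h
    · exact le_trans (by linarith) (hnn t)
    · have hm : MonotoneOn (fun t => (∫ s in (0:ℝ)..t, ψ1 s) - t) (Ici (2 * η)) := by
        apply monotoneOn_of_hasDerivWithinAt_nonneg (convex_Ici _) (f' := fun t => ψ1 t - 1)
        · exact fun t _ => ((hd t).sub (hasDerivAt_id t)).continuousAt.continuousWithinAt
        · exact fun t _ => ((hd t).sub (hasDerivAt_id t)).hasDerivWithinAt
        · intro t ht
          rw [interior_Ici] at ht
          have ht' : 2 * η < t := ht
          have : ψ1 t = 1 := by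
            apply Real.smoothTransition.one_of_one_le
            rw [le_sub_iff_add_le, le_div_iff₀ hη]; linarith
          simp [this]
      have h2 := hm self_mem_Ici h h
      have h3 := hnn (2 * η)
      simp only at h2
      linarith

lemma lap_continuous {n : ℕ} {u : EuclideanSpace ℝ (Fin n) → ℝ} (hu : ContDiff ℝ 2 u) :
    Continuous (lap u) := by
  rw [show lap u = _ from funext (lap_eq_sum u hu)]
  refine continuous_finsetSum _ fun i _ => ?_
  have h1 : ContDiff ℝ 1 (fun y => fderiv ℝ u y (EuclideanSpace.single i (1:ℝ))) :=
    (hu.fderiv_right (m := 1) (by norm_num)).clm_apply contDiff_const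
  exact (h1.continuous_fderiv (by norm_num)).clm_apply continuous_const

lemma green {n : ℕ} {k φ : EuclideanSpace ℝ (Fin n) → ℝ} (hk : ContDiff ℝ 2 k)
    (hφ : ContDiff ℝ 2 φ) (hc : HasCompactSupport φ) :
    ∫ x, k x * lap φ x = ∫ x, lap k x * φ x := by
  have D1 : ∀ {g : EuclideanSpace ℝ (Fin n) → ℝ}, ContDiff ℝ 2 g → ∀ i : Fin n,
      ContDiff ℝ 1 (fun y => fderiv ℝ g y (EuclideanSpace.single i (1:ℝ))) := fun hg i =>
    (hg.fderiv_right (m := 1) (by norm_num)).clm_apply contDiff_const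
  have D2 : ∀ {g : EuclideanSpace ℝ (Fin n) → ℝ}, ContDiff ℝ 1 g → ∀ i : Fin n,
      Continuous (fun y => fderiv ℝ g y (EuclideanSpace.single i (1:ℝ))) := fun hg i =>
    (hg.continuous_fderiv (by norm_num)).clm_apply continuous_const
  have hc1 : ∀ i : Fin n, HasCompactSupport
      (fun y => fderiv ℝ φ y (EuclideanSpace.single i (1:ℝ))) := fun i =>
    hc.fderiv_apply ℝ _
  have hc2 : ∀ i : Fin n, HasCompactSupport (fun x => fderiv ℝ
      (fun y => fderiv ℝ φ y (EuclideanSpace.single i (1:ℝ))) x (EuclideanSpace.single i (1:ℝ))) :=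
    fun i => (hc1 i).fderiv_apply ℝ _
  have dk : Differentiable ℝ k := hk.differentiable (by norm_num)
  have dφ : Differentiable ℝ φ := hφ.differentiable (by norm_num)
  have hφ1 : ContDiff ℝ 1 φ := hφ.of_le (by norm_num)
  have hk1 : ContDiff ℝ 1 k := hk.of_le (by norm_num)
  simp_rw [lap_eq_sum k hk, lap_eq_sum φ hφ, Finset.mul_sum, Finset.sum_mul]
  rw [integral_finsetSum, integral_finsetSum]
  · refine Finset.sum_congr rfl fun i _ => ?_
    have hA := integral_mul_fderiv_eq_neg_fderiv_mul_of_integrable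
      (μ := (volume : Measure (EuclideanSpace ℝ (Fin n)))) (v := EuclideanSpace.single i (1:ℝ))
      (f := k) (g := fun y => fderiv ℝ φ y (EuclideanSpace.single i (1:ℝ)))
      (((D2 hk1 i).mul (D2 hφ1 i)).integrable_of_hasCompactSupport (hc1 i).mul_left)
      ((hk.continuous.mul (D2 (D1 hφ i) i)).integrable_of_hasCompactSupport (hc2 i).mul_left)
      ((hk.continuous.mul (D2 hφ1 i)).integrable_of_hasCompactSupport (hc1 i).mul_left)
      (fun x _ => dk x)
      (fun x _ => (D1 hφ i).differentiable (by norm_num) x)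
    have hB := integral_mul_fderiv_eq_neg_fderiv_mul_of_integrable
      (μ := (volume : Measure (EuclideanSpace ℝ (Fin n)))) (v := EuclideanSpace.single i (1:ℝ))
      (f := fun y => fderiv ℝ k y (EuclideanSpace.single i (1:ℝ))) (g := φ)
      ((((D2 (D1 hk i) i)).mul hφ.continuous).integrable_of_hasCompactSupport hc.mul_left)
      (((D2 hk1 i).mul (D2 hφ1 i)).integrable_of_hasCompactSupport (hc1 i).mul_left)
      (((D2 hk1 i).mul hφ.continuous).integrable_of_hasCompactSupport hc.mul_left)
      (fun x _ => (D1 hk i).differentiable (by norm_num) x)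
      (fun x _ => dφ x)
    rw [hA, hB, neg_neg]
  · intro i _
    exact (((D2 (D1 hk i) i)).mul hφ.continuous).integrable_of_hasCompactSupport hc.mul_left
  · intro i _
    exact (hk.continuous.mul (D2 (D1 hφ i) i)).integrable_of_hasCompactSupport (hc2 i).mul_left

/-- the radial profile of the (regularised) fundamental solution -/
def hker (n : ℕ) (L ρ : ℝ) : ℝ := ∫ s in ρ..L, s ^ (-(n:ℝ) / 2)

lemma hker_hasDeriv (n : ℕ) {L ρ : ℝ} (hL : 0 < L) (hρ : 0 < ρ) :
    HasDerivAt (hker n L) (- ρ ^ (-(n:ℝ) / 2)) ρ := by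
  have hc : ContinuousOn (fun s : ℝ => s ^ (-(n:ℝ) / 2)) (Ioi 0) :=
    continuousOn_id.rpow_const fun x hx => Or.inl (ne_of_gt hx)
  apply intervalIntegral.integral_hasDerivAt_left
  · apply (hc.mono _).intervalIntegrable
    intro x hx
    exact lt_of_lt_of_le (lt_min hρ hL) hx.1
  · exact (hc.stronglyMeasurableAtFilter isOpen_Ioi) ρ hρ
  · exact hc.continuousAt (Ioi_mem_nhds hρ)

lemma hker_contDiffOn (n : ℕ) {L : ℝ} (hL : 0 < L) : ContDiffOn ℝ 2 (hker n L) (Ioi 0) := by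
  rw [show (2 : WithTop ℕ∞) = 1 + 1 by norm_num, contDiffOn_succ_iff_deriv_of_isOpen isOpen_Ioi]
  refine ⟨fun t ht => (hker_hasDeriv n hL ht).differentiableAt.differentiableWithinAt, by simp, ?_⟩
  have : ContDiffOn ℝ 1 (fun ρ : ℝ => - ρ ^ (-(n:ℝ) / 2)) (Ioi 0) :=
    (contDiffOn_id.rpow_const_of_ne fun x hx => ne_of_gt hx).neg
  exact this.congr fun t ht => (hker_hasDeriv n hL ht).deriv

lemma hker_nonneg (n : ℕ) {L ρ : ℝ} (hρ : 0 < ρ) (h : ρ ≤ L) : 0 ≤ hker n L ρ := by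
  apply intervalIntegral.integral_nonneg h
  intro s hs
  exact Real.rpow_nonneg (by linarith [hs.1]) _

lemma hker_le {n : ℕ} (hn : 1 ≤ n) (hn7 : n ≤ 7) {L ρ : ℝ} (hρ : 0 < ρ) (h : ρ ≤ L) :
    hker n L ρ ≤ L ^ (1 - (n:ℝ) / 7) * (14 / (5 * n)) * ρ ^ (-(5 * (n:ℝ) / 14)) := by
  have hn' : (1:ℝ) ≤ n := by exact_mod_cast hn
  have hn7' : (n:ℝ) ≤ 7 := by exact_mod_cast hn7
  have hL : 0 < L := by linarith
  have h0 : (0:ℝ) ∉ uIcc ρ L := by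
    rw [uIcc_of_le h]; intro hx; linarith [hx.1]
  have hle : hker n L ρ ≤ ∫ s in ρ..L, L ^ (1 - (n:ℝ) / 7) * s ^ (-1 - 5 * (n:ℝ) / 14) := by
    apply intervalIntegral.integral_mono_on h
    · exact intervalIntegral.intervalIntegrable_rpow (Or.inr h0)
    · exact (intervalIntegral.intervalIntegrable_rpow (Or.inr h0)).const_mul _
    · intro s hs
      have hs0 : 0 < s := by linarith [hs.1]
      have : s ^ (-(n:ℝ) / 2) = s ^ (1 - (n:ℝ) / 7) * s ^ (-1 - 5 * (n:ℝ) / 14) := by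
        rw [← Real.rpow_add hs0]; congr 1; ring
      rw [this]
      apply mul_le_mul_of_nonneg_right _ (Real.rpow_nonneg hs0.le _)
      exact Real.rpow_le_rpow hs0.le hs.2 (by linarith)
  refine hle.trans ?_
  rw [intervalIntegral.integral_const_mul, integral_rpow (Or.inr ⟨by linarith, h0⟩), mul_assoc]
  apply mul_le_mul_of_nonneg_left _ (Real.rpow_nonneg hL.le _)
  have e : (-1 - 5 * (n:ℝ) / 14 + 1) = -(5 * (n:ℝ) / 14) := by ring
  rw [e]
  have h1 : 0 ≤ L ^ (-(5 * (n:ℝ) / 14)) := Real.rpow_nonneg hL.le _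
  have e2 : (L ^ (-(5 * (n:ℝ) / 14)) - ρ ^ (-(5 * (n:ℝ) / 14))) / -(5 * (n:ℝ) / 14) =
      14 / (5 * n) * (ρ ^ (-(5 * (n:ℝ) / 14)) - L ^ (-(5 * (n:ℝ) / 14))) := by
    field_simp
    ring
  rw [e2]
  apply mul_le_mul_of_nonneg_left _ (by positivity)
  linarith

lemma lap_kernel {n : ℕ} {L δ : ℝ} (hL : 0 < L) (hδ : 0 < δ) (x0 : EuclideanSpace ℝ (Fin n)) :
    ContDiff ℝ 2 (fun x => hker n L (‖x - x0‖ ^ 2 + δ ^ 2)) ∧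
    ∀ x, lap (fun x => hker n L (‖x - x0‖ ^ 2 + δ ^ 2)) x =
      - (2 * n * δ ^ 2 * (‖x - x0‖ ^ 2 + δ ^ 2) ^ (-(n:ℝ) / 2 - 1)) := by
  set q : EuclideanSpace ℝ (Fin n) → ℝ := fun x => ‖x - x0‖ ^ 2 + δ ^ 2 with hqdef
  have hq : ContDiff ℝ 2 q := by
    exact ((contDiff_id.sub contDiff_const).norm_sq ℝ).add contDiff_const
  have hqpos : ∀ x, 0 < q x := fun x => by positivity
  have hc : ContDiff ℝ 2 (fun x => hker n L (q x)) := by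
    rw [contDiff_iff_contDiffAt]
    intro x
    exact ((hker_contDiffOn n hL).contDiffAt (Ioi_mem_nhds (hqpos x))).comp x hq.contDiffAt
  refine ⟨hc, fun x => ?_⟩
  have hd : ∀ y e, fderiv ℝ q y e = 2 * inner ℝ (y - x0) e := by
    intro y e
    have h1 : HasFDerivAt (fun x : EuclideanSpace ℝ (Fin n) => x - x0)
      (ContinuousLinearMap.id ℝ _) y := (hasFDerivAt_id y).sub_const x0
    have h2 := (h1.norm_sq.add_const (δ ^ 2)).fderiv
    change fderiv ℝ q y = _ at h2
    rw [h2]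
    simp [inner_sub_left]
  have hd' : ∀ y (i : Fin n), fderiv ℝ q y (EuclideanSpace.single i (1:ℝ)) = 2 * (y - x0) i := by
    intro y i
    rw [hd, EuclideanSpace.inner_single_right]
    simp
  have hsum : ∑ i : Fin n, (fderiv ℝ q x (EuclideanSpace.single i (1:ℝ))) ^ 2
      = 4 * ‖x - x0‖ ^ 2 := by
    simp_rw [hd']
    rw [EuclideanSpace.norm_sq_eq, Finset.mul_sum]
    refine Finset.sum_congr rfl fun i _ => ?_
    rw [Real.norm_eq_abs, sq_abs]; ring
  have hlq : lap q x = 2 * n := by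
    rw [lap_eq_sum q hq]
    have : ∀ i : Fin n, fderiv ℝ (fun y => fderiv ℝ q y (EuclideanSpace.single i (1:ℝ))) x
        (EuclideanSpace.single i (1:ℝ)) = 2 := by
      intro i
      simp_rw [hd']
      have h1 : HasFDerivAt (fun y : EuclideanSpace ℝ (Fin n) => 2 * (y - x0) i)
          ((2:ℝ) • (EuclideanSpace.proj i : EuclideanSpace ℝ (Fin n) →L[ℝ] ℝ)) x := by
        have h2 := ((EuclideanSpace.proj i : EuclideanSpace ℝ (Fin n) →L[ℝ] ℝ).hasFDerivAt
          (x := x)).sub_const (x0 i)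
        exact h2.const_mul 2
      rw [h1.fderiv]
      simp
    simp_rw [this]
    simp; ring
  have hx := hqpos x
  have h2 : HasDerivAt (fun ρ : ℝ => - ρ ^ (-(n:ℝ) / 2))
      (-((-(n:ℝ) / 2) * (q x) ^ (-(n:ℝ) / 2 - 1))) (q x) :=
    (Real.hasDerivAt_rpow_const (Or.inl hx.ne')).neg
  have := lap_comp hq hc (x := x) (h1 := fun ρ : ℝ => - ρ ^ (-(n:ℝ) / 2))
    (by filter_upwards [Ioi_mem_nhds hx] with t ht using hker_hasDeriv n hL ht) h2
  rw [this, hsum, hlq]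
  have e : (q x) ^ (-(n:ℝ) / 2) = q x * (q x) ^ (-(n:ℝ) / 2 - 1) := by
    rw [Real.rpow_sub_one hx.ne']; field_simp
  have e2 : ‖x - x0‖ ^ 2 = q x - δ ^ 2 := by simp [hqdef]
  change _ = - (2 * n * δ ^ 2 * (q x) ^ (-(n:ℝ) / 2 - 1))
  rw [e, e2]
  ring

lemma cutoff {n : ℕ} {Ω : Set (EuclideanSpace ℝ (Fin n))} (hΩ : GoodDomain Ω)
    {w : EuclideanSpace ℝ (Fin n) → ℝ} (hw : ContDiff ℝ 2 w)
    (hb : ∀ x ∈ frontier Ω, w x = 0) (hl : ∀ x ∈ Ω, 0 ≤ - lap w x) {η : ℝ} (hη : 0 < η) :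
    ∃ φ : EuclideanSpace ℝ (Fin n) → ℝ, ContDiff ℝ 2 φ ∧ HasCompactSupport φ ∧
      (∀ x, 0 ≤ φ x) ∧ (∀ x ∉ Ω, lap φ x = 0) ∧ (∀ x ∈ Ω, - lap φ x ≤ - lap w x) ∧
      (∀ x ∈ Ω, w x - 2 * η ≤ φ x) := by
  obtain ⟨ψ, ψ1, ψ2, hψ, hψ1, hψ2, h10, h11, h20, hz, hnn, hlow⟩ := exists_psi hη
  classical
  set φ : EuclideanSpace ℝ (Fin n) → ℝ := Ω.indicator (fun x => ψ (w x)) with hφ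
  have hin : ∀ x ∈ Ω, φ =ᶠ[𝓝 x] fun x => ψ (w x) := by
    intro x hx
    filter_upwards [hΩ.1.mem_nhds hx] with y hy
    simp [hφ, hy]
  have hout : ∀ x ∉ Ω, φ =ᶠ[𝓝 x] fun _ => 0 := by
    intro x hx
    by_cases hxc : x ∈ closure Ω
    · have h0 : w x = 0 := hb x (by rw [hΩ.1.frontier_eq]; exact ⟨hxc, hx⟩)
      have : ∀ᶠ y in 𝓝 x, w y < η :=
        hw.continuous.continuousAt.eventually_lt continuousAt_const (by rw [h0]; exact hη)
      filter_upwards [this] with y hy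
      by_cases hyΩ : y ∈ Ω
      · simp [hφ, hyΩ, hz _ hy.le]
      · simp [hφ, hyΩ]
    · filter_upwards [isClosed_closure.isOpen_compl.mem_nhds hxc] with y hy
      have : y ∉ Ω := fun h => hy (subset_closure h)
      simp [hφ, this]
  have hcomp : ContDiff ℝ 2 (fun x => ψ (w x)) := hψ.comp hw
  refine ⟨φ, ?_, ?_, ?_, ?_, ?_, ?_⟩
  · rw [contDiff_iff_contDiffAt]
    intro x
    by_cases hx : x ∈ Ω
    · exact hcomp.contDiffAt.congr_of_eventuallyEq (hin x hx)
    · exact contDiffAt_const.congr_of_eventuallyEq (hout x hx)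
  · apply HasCompactSupport.intro hΩ.2.1.isCompact_closure
    intro x hx
    have : x ∉ Ω := fun h => hx (subset_closure h)
    simp [hφ, this]
  · intro x
    exact indicator_nonneg (fun y _ => hnn _) x
  · intro x hx
    rw [lap_congr (hout x hx)]
    simp [lap_eq_sum _ (contDiff_const (n := 2) (c := (0:ℝ)))]
  · intro x hx
    rw [lap_congr (hin x hx), lap_comp hw hcomp (Eventually.of_forall hψ1) (hψ2 (w x))]
    have h1 := hl x hx
    have h2 : 0 ≤ ψ2 (w x) * ∑ i : Fin n, (fderiv ℝ w x (EuclideanSpace.single i (1:ℝ))) ^ 2 :=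
      mul_nonneg (h20 _) (Finset.sum_nonneg fun i _ => sq_nonneg _)
    nlinarith [h11 (w x), h10 (w x)]
  · intro x hx
    simp only [hφ, indicator_of_mem hx]
    exact hlow _

lemma potential_step {n : ℕ} {Ω : Set (EuclideanSpace ℝ (Fin n))} (hΩ : GoodDomain Ω)
    {D : ℝ} (hD : ∀ x ∈ Ω, ∀ y ∈ Ω, ‖y - x‖ ≤ D)
    {w : EuclideanSpace ℝ (Fin n) → ℝ} (hw : ContDiff ℝ 2 w)
    (hb : ∀ x ∈ frontier Ω, w x = 0) (hl : ∀ x ∈ Ω, 0 ≤ - lap w x) {η : ℝ} (hη : 0 < η)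
    {x0 : EuclideanSpace ℝ (Fin n)} (hx0 : x0 ∈ Ω) :
    ∃ δ : ℝ, 0 < δ ∧ δ ≤ 1 ∧
      n * (2:ℝ) ^ (-(n:ℝ) / 2) * volume.real (Metric.ball (0 : EuclideanSpace ℝ (Fin n)) 1) *
        (w x0 - 3 * η) ≤
      ∫ x in Ω, hker n (D ^ 2 + 1) (‖x - x0‖ ^ 2 + δ ^ 2) * (- lap w x) := by
  obtain ⟨φ, hφ, hφc, hφ0, hφl, hφl2, hφw⟩ := cutoff hΩ hw hb hl hη
  obtain ⟨δ', hδ', hball⟩ := Metric.continuous_iff.mp hφ.continuous x0 η hη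
  set δ := min δ' 1 with hδdef
  have hδ : 0 < δ := lt_min hδ' one_pos
  have hδ1 : δ ≤ 1 := min_le_right _ _
  refine ⟨δ, hδ, hδ1, ?_⟩
  have hL : 0 < D ^ 2 + 1 := by positivity
  obtain ⟨hk, hlk⟩ := lap_kernel (n := n) hL hδ x0
  have hG := green hk hφ hφc
  set k : EuclideanSpace ℝ (Fin n) → ℝ :=
    fun x => hker n (D ^ 2 + 1) (‖x - x0‖ ^ 2 + δ ^ 2) with hkdef
  have hρ : ∀ x : EuclideanSpace ℝ (Fin n), 0 < ‖x - x0‖ ^ 2 + δ ^ 2 := fun x => by positivity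
  have hknn : ∀ x ∈ Ω, 0 ≤ k x := by
    intro x hx
    apply hker_nonneg n (hρ x)
    have h1 := hD x0 hx0 x hx
    have h2 := norm_nonneg (x - x0)
    nlinarith
  have hlφc : Continuous (lap φ) := lap_continuous hφ
  have hlwc : Continuous (lap w) := lap_continuous hw
  -- upper bound
  have hup : ∫ x, k x * (- lap φ x) ≤ ∫ x in Ω, k x * (- lap w x) := by
    have h1 : ∫ x, k x * (- lap φ x) = ∫ x in Ω, k x * (- lap φ x) := by
      symm
      apply setIntegral_eq_integral_of_forall_compl_eq_zero
      intro x hx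
      rw [hφl x hx]; simp
    rw [h1]
    have hI : ∀ g : EuclideanSpace ℝ (Fin n) → ℝ, Continuous g → IntegrableOn g Ω := fun g hg =>
      (hg.continuousOn.integrableOn_compact hΩ.2.1.isCompact_closure).mono_set subset_closure
    apply setIntegral_mono_on (hI _ (hk.continuous.mul hlφc.neg)) (hI _ (hk.continuous.mul hlwc.neg))
      hΩ.1.measurableSet
    intro x hx
    exact mul_le_mul_of_nonneg_left (hφl2 x hx) (hknn x hx)
  have hG' : ∫ x, k x * (- lap φ x) =
      ∫ x, 2 * n * δ ^ 2 * (‖x - x0‖ ^ 2 + δ ^ 2) ^ (-(n:ℝ) / 2 - 1) * φ x := by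
    simp_rw [mul_neg]
    rw [integral_neg, hG, ← integral_neg]
    congr 1
    funext x
    rw [hlk x]; ring
  refine le_trans ?_ hup
  rw [hG']
  set a : ℝ := -(n:ℝ) / 2 - 1 with ha
  have ha0 : a ≤ 0 := by
    have : (0:ℝ) ≤ n := Nat.cast_nonneg n
    rw [ha]; linarith
  have hgc : Continuous (fun x => 2 * n * δ ^ 2 * (‖x - x0‖ ^ 2 + δ ^ 2) ^ a * φ x) := by
    apply Continuous.mul _ hφ.continuous
    apply continuous_const.mul
    apply Continuous.rpow_const (by fun_prop)
    intro x; exact Or.inl (hρ x).ne'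
  have hgi : Integrable (fun x => 2 * n * δ ^ 2 * (‖x - x0‖ ^ 2 + δ ^ 2) ^ a * φ x) :=
    hgc.integrable_of_hasCompactSupport hφc.mul_left
  have hnn : ∀ x, 0 ≤ 2 * n * δ ^ 2 * (‖x - x0‖ ^ 2 + δ ^ 2) ^ a * φ x := fun x => by
    have := Real.rpow_nonneg (hρ x).le a
    have := hφ0 x
    positivity
  have hle : ∫ x in Metric.ball x0 δ, (2 * n * δ ^ 2 * (2 * δ ^ 2) ^ a * (φ x0 - η)) ≤
      ∫ x, 2 * n * δ ^ 2 * (‖x - x0‖ ^ 2 + δ ^ 2) ^ a * φ x := by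
    refine le_trans ?_ (setIntegral_le_integral hgi (ae_of_all _ hnn) (s := Metric.ball x0 δ))
    apply setIntegral_mono_on _ hgi.integrableOn measurableSet_ball
    · intro x hx
      have hx' : dist x x0 < δ := hx
      have h1 : ‖x - x0‖ < δ := by rwa [← dist_eq_norm]
      have h2 : dist (φ x) (φ x0) < η := hball x (lt_of_lt_of_le hx' (min_le_left _ _))
      rw [Real.dist_eq, abs_lt] at h2
      have h3 : (2 * δ ^ 2) ^ a ≤ (‖x - x0‖ ^ 2 + δ ^ 2) ^ a := by
        apply Real.rpow_le_rpow_of_nonpos (hρ x) _ ha0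
        have := norm_nonneg (x - x0)
        nlinarith
      have h4 : 0 ≤ (2 * δ ^ 2) ^ a := by positivity
      have h5 : 0 ≤ 2 * n * δ ^ 2 := by positivity
      have h6 := hφ0 x
      calc 2 * n * δ ^ 2 * (2 * δ ^ 2) ^ a * (φ x0 - η)
          ≤ 2 * n * δ ^ 2 * (2 * δ ^ 2) ^ a * φ x := by
            apply mul_le_mul_of_nonneg_left (by linarith) (by positivity)
        _ ≤ _ := by gcongr
    · exact integrableOn_const (by exact measure_ball_lt_top.ne)
  refine le_trans ?_ hle
  rw [setIntegral_const, smul_eq_mul]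
  have hvol : volume.real (Metric.ball x0 δ) =
      δ ^ n * volume.real (Metric.ball (0 : EuclideanSpace ℝ (Fin n)) 1) := by
    rw [Measure.real, Measure.addHaar_ball_of_pos _ _ hδ, ENNReal.toReal_mul,
      ENNReal.toReal_ofReal (by positivity)]
    simp [Measure.real]
  rw [hvol]
  have hpow : δ ^ n * (2 * n * δ ^ 2 * (2 * δ ^ 2) ^ a) = n * (2:ℝ) ^ (-(n:ℝ) / 2) := by
    rw [Real.mul_rpow (by norm_num) (by positivity), ← Real.rpow_natCast δ 2,
      ← Real.rpow_natCast δ n, ← Real.rpow_mul hδ.le]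
    have e1 : (2:ℝ) ^ (-(n:ℝ) / 2) = 2 * 2 ^ a := by
      rw [ha, Real.rpow_sub_one (by norm_num)]; ring
    have e2 : δ ^ (n:ℝ) * δ ^ ((2:ℕ):ℝ) * δ ^ (((2:ℕ):ℝ) * a) = 1 := by
      rw [← Real.rpow_add hδ, ← Real.rpow_add hδ, ha]
      have : (n:ℝ) + ((2:ℕ):ℝ) + ((2:ℕ):ℝ) * (-(n:ℝ) / 2 - 1) = 0 := by push_cast; ring
      rw [this, Real.rpow_zero]
    rw [e1]
    linear_combination 2 * n * 2 ^ a * e2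
  have hv0 : 0 ≤ volume.real (Metric.ball (0 : EuclideanSpace ℝ (Fin n)) 1) := measureReal_nonneg
  calc _ ≤ n * (2:ℝ) ^ (-(n:ℝ) / 2) * volume.real (Metric.ball (0 : EuclideanSpace ℝ (Fin n)) 1) *
        (φ x0 - η) := by
          apply mul_le_mul_of_nonneg_left _ (by positivity)
          linarith [hφw x0 hx0]
    _ = _ := by rw [← hpow]; ring

lemma potential {n : ℕ} (hn : 1 ≤ n) (hn7 : n ≤ 7) {Ω : Set (EuclideanSpace ℝ (Fin n))}
    (hΩ : GoodDomain Ω) : ∃ C : ENNReal, C ≠ ⊤ ∧ ∀ w : EuclideanSpace ℝ (Fin n) → ℝ,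
      ContDiff ℝ 2 w → (∀ x ∈ frontier Ω, w x = 0) → (∀ x ∈ Ω, 0 ≤ - lap w x) → ∀ x0 ∈ Ω,
      ENNReal.ofReal (w x0) ≤ C * ∫⁻ y in Ω, (ENNReal.ofReal ‖y - x0‖) ^ (-(5 * (n:ℝ) / 7)) *
        ENNReal.ofReal (- lap w y) := by
  obtain ⟨D, hD'⟩ := hΩ.2.1.exists_norm_le
  have hD : ∀ x ∈ Ω, ∀ y ∈ Ω, ‖y - x‖ ≤ 2 * D := fun x hx y hy => by
    have := norm_sub_le y x
    linarith [hD' x hx, hD' y hy]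
  have hn' : (0:ℝ) < n := by exact_mod_cast hn
  set A : ℝ := n * (2:ℝ) ^ (-(n:ℝ) / 2) *
    volume.real (Metric.ball (0 : EuclideanSpace ℝ (Fin n)) 1) with hA
  have hA0 : 0 < A := by
    have : 0 < volume.real (Metric.ball (0 : EuclideanSpace ℝ (Fin n)) 1) :=
      ENNReal.toReal_pos (Metric.measure_ball_pos _ _ one_pos).ne' measure_ball_lt_top.ne
    positivity
  set L : ℝ := (2 * D) ^ 2 + 1 with hLdef
  have hL : 0 < L := by positivity
  set B : ℝ := L ^ (1 - (n:ℝ) / 7) * (14 / (5 * n)) with hB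
  have hB0 : 0 < B := by positivity
  refine ⟨(ENNReal.ofReal A)⁻¹ * ENNReal.ofReal B,
    ENNReal.mul_ne_top (ENNReal.inv_ne_top.mpr (by simpa using hA0)) ENNReal.ofReal_ne_top, ?_⟩
  intro w hw hb hl x0 hx0
  set J : ENNReal := ∫⁻ y in Ω, (ENNReal.ofReal ‖y - x0‖) ^ (-(5 * (n:ℝ) / 7)) *
        ENNReal.ofReal (- lap w y) with hJ
  have hstep : ∀ η : ℝ, 0 < η → ENNReal.ofReal (A * (w x0 - 3 * η)) ≤ ENNReal.ofReal B * J := by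
    intro η hη
    obtain ⟨δ, hδ, hδ1, h⟩ := potential_step hΩ hD hw hb hl hη hx0
    refine (ENNReal.ofReal_le_ofReal h).trans ?_
    have hρ : ∀ x : EuclideanSpace ℝ (Fin n), 0 < ‖x - x0‖ ^ 2 + δ ^ 2 := fun x => by positivity
    have hρL : ∀ x ∈ Ω, ‖x - x0‖ ^ 2 + δ ^ 2 ≤ L := by
      intro x hx
      have h1 := hD x0 hx0 x hx
      have h2 := norm_nonneg (x - x0)
      nlinarith
    have hc : Continuous fun x => hker n L (‖x - x0‖ ^ 2 + δ ^ 2) * (- lap w x) :=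
      (lap_kernel hL hδ x0).1.continuous.mul (lap_continuous hw).neg
    rw [ofReal_integral_eq_lintegral_ofReal
      ((hc.continuousOn.integrableOn_compact hΩ.2.1.isCompact_closure).mono_set subset_closure)
      ((ae_restrict_iff' hΩ.1.measurableSet).mpr (ae_of_all _ fun x hx =>
        mul_nonneg (hker_nonneg n (hρ x) (hρL x hx)) (hl x hx))),
      hJ, ← lintegral_const_mul' _ _ ENNReal.ofReal_ne_top]
    apply setLIntegral_mono' hΩ.1.measurableSet
    intro x hx
    rw [ENNReal.ofReal_mul (hker_nonneg n (hρ x) (hρL x hx)), ← mul_assoc]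
    apply mul_le_mul_left
    by_cases hz : ‖x - x0‖ = 0
    · rw [hz, ENNReal.ofReal_zero, ENNReal.zero_rpow_of_neg (by
        have : 0 < 5 * (n:ℝ) / 7 := by positivity
        linarith), ENNReal.mul_top (by simpa using hB0)]
      exact le_top
    · have hpos : 0 < ‖x - x0‖ := lt_of_le_of_ne (norm_nonneg _) (Ne.symm hz)
      rw [ENNReal.ofReal_rpow_of_pos hpos, ← ENNReal.ofReal_mul hB0.le]
      apply ENNReal.ofReal_le_ofReal
      refine (hker_le hn hn7 (hρ x) (hρL x hx)).trans ?_
      apply mul_le_mul_of_nonneg_left _ hB0.le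
      have e : ‖x - x0‖ ^ (-(5 * (n:ℝ) / 7)) = (‖x - x0‖ ^ 2) ^ (-(5 * (n:ℝ) / 14)) := by
        rw [← Real.rpow_natCast, ← Real.rpow_mul hpos.le]
        congr 1; push_cast; ring
      rw [e]
      apply Real.rpow_le_rpow_of_nonpos (by positivity) (by nlinarith)
      have : 0 < 5 * (n:ℝ) / 14 := by positivity
      linarith
  have hlimit : ENNReal.ofReal (A * w x0) ≤ ENNReal.ofReal B * J := by
    have ht : Tendsto (fun η : ℝ => ENNReal.ofReal (A * (w x0 - 3 * η))) (𝓝[>] 0)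
        (𝓝 (ENNReal.ofReal (A * (w x0 - 3 * 0)))) := by
      apply Tendsto.mono_left _ nhdsWithin_le_nhds
      exact (ENNReal.continuous_ofReal.comp (by fun_prop :
        Continuous fun η : ℝ => A * (w x0 - 3 * η))).tendsto 0
    have := le_of_tendsto ht (by filter_upwards [self_mem_nhdsWithin] with η hη using hstep η hη)
    simpa using this
  rw [ENNReal.ofReal_mul hA0.le] at hlimit
  rw [mul_assoc, ← ENNReal.mul_le_iff_le_inv (by simpa using hA0) ENNReal.ofReal_ne_top]
  exact hlimit

lemma kernel_int {n : ℕ} (hn : 1 ≤ n) {Ω : Set (EuclideanSpace ℝ (Fin n))} (hΩ : GoodDomain Ω)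
    {β : ℝ} (hβ : β < n) : ∃ K : ENNReal, K ≠ ⊤ ∧ ∀ x ∈ Ω,
      ∫⁻ y in Ω, (ENNReal.ofReal ‖y - x‖) ^ (-β) ≤ K := by
  obtain ⟨D, hD'⟩ := hΩ.2.1.exists_norm_le
  have : NeZero n := ⟨by omega⟩
  set F : EuclideanSpace ℝ (Fin n) → ENNReal := fun y => (ENNReal.ofReal ‖y‖) ^ (-β) with hF
  have hfr : Module.finrank ℝ (EuclideanSpace ℝ (Fin n)) = n := by simp
  have hint0 : IntegrableOn (fun y : EuclideanSpace ℝ (Fin n) => ‖y‖ ^ (-β))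
      (Metric.ball 0 (2 * D + 1)) := by
    apply integrableOn_ball_of_norm_le_rpow (C := 1) (α := β)
    · rw [hfr]; exact hβ
    · apply ae_of_all
      intro x
      rw [one_mul, Real.norm_of_nonneg (Real.rpow_nonneg (norm_nonneg _) _)]
    · exact (measurable_norm.pow_const _).aestronglyMeasurable
    · rw [hfr]; exact hn
  refine ⟨∫⁻ y in Metric.ball (0 : EuclideanSpace ℝ (Fin n)) (2 * D + 1), F y, ?_, ?_⟩
  · have h1 : ∫⁻ y in Metric.ball (0 : EuclideanSpace ℝ (Fin n)) (2 * D + 1), F y =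
        ∫⁻ y in Metric.ball (0 : EuclideanSpace ℝ (Fin n)) (2 * D + 1),
          ENNReal.ofReal (‖y‖ ^ (-β)) := by
      apply lintegral_congr_ae
      apply ae_restrict_of_ae
      have : ∀ᵐ y : EuclideanSpace ℝ (Fin n), y ≠ 0 := by
        simp [ae_iff]
      filter_upwards [this] with y hy
      simp only [hF]
      rw [ENNReal.ofReal_rpow_of_pos (norm_pos_iff.mpr hy)]
    rw [h1]
    have := hint0.lintegral_lt_top
    exact this.ne
  · intro x hx
    rw [← lintegral_indicator hΩ.1.measurableSet, ← lintegral_indicator measurableSet_ball,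
      ← lintegral_sub_right_eq_self ((Metric.ball (0 : EuclideanSpace ℝ (Fin n))
        (2 * D + 1)).indicator F) x]
    apply lintegral_mono
    intro y
    by_cases hy : y ∈ Ω
    · have : y - x ∈ Metric.ball (0 : EuclideanSpace ℝ (Fin n)) (2 * D + 1) := by
        rw [mem_ball_zero_iff]
        have := norm_sub_le y x
        linarith [hD' x hx, hD' y hy]
      beta_reduce
      rw [indicator_of_mem hy, indicator_of_mem this]
    · simp [hy]

lemma young3 {X Y g : ENNReal} {p s : ℝ} (hp : 1 < p) (hs : s = 2 * p / (2 * p - 1)) :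
    X * Y * g ≤ X ^ s * Y ^ s + Y ^ s * g ^ p + X ^ s * g ^ p := by
  have hp0 : 0 < p := by linarith
  have h2p : 0 < 2 * p - 1 := by linarith
  set T := X ^ s * Y ^ s + Y ^ s * g ^ p + X ^ s * g ^ p with hT
  have h1 : X ^ s * Y ^ s ≤ T := by
    rw [hT, add_assoc]; exact le_self_add
  have h2 : Y ^ s * g ^ p ≤ T := by
    rw [hT, add_right_comm]; exact le_add_self
  have h3 : X ^ s * g ^ p ≤ T := le_add_self
  have t1 : 0 ≤ 1 - 1 / p := by
    have : 1 / p ≤ 1 := by rw [div_le_one hp0]; exact hp.le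
    linarith
  have t2 : 0 ≤ 1 / (2 * p) := by positivity
  have es : s * (1 - 1 / p) + s * (1 / (2 * p)) = 1 := by
    rw [hs]; field_simp; ring
  have ep : p * (1 / (2 * p)) + p * (1 / (2 * p)) = 1 := by field_simp; norm_num
  have hs0 : 0 < s := by rw [hs]; positivity
  calc X * Y * g = (X ^ s * Y ^ s) ^ (1 - 1 / p) * (Y ^ s * g ^ p) ^ (1 / (2 * p)) *
        (X ^ s * g ^ p) ^ (1 / (2 * p)) := by
        rw [ENNReal.mul_rpow_of_nonneg _ _ t1, ENNReal.mul_rpow_of_nonneg _ _ t2,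
          ENNReal.mul_rpow_of_nonneg _ _ t2]
        simp only [← ENNReal.rpow_mul]
        have hX : X = X ^ (s * (1 - 1 / p)) * X ^ (s * (1 / (2 * p))) := by
          rw [← ENNReal.rpow_add_of_nonneg _ _ (by positivity) (by positivity), es,
            ENNReal.rpow_one]
        have hY : Y = Y ^ (s * (1 - 1 / p)) * Y ^ (s * (1 / (2 * p))) := by
          rw [← ENNReal.rpow_add_of_nonneg _ _ (by positivity) (by positivity), es,
            ENNReal.rpow_one]
        have hg : g = g ^ (p * (1 / (2 * p))) * g ^ (p * (1 / (2 * p))) := by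
          rw [← ENNReal.rpow_add_of_nonneg _ _ (by positivity) (by positivity), ep,
            ENNReal.rpow_one]
        conv_lhs => rw [hX, hY, hg]
        ring
    _ ≤ T ^ (1 - 1 / p) * T ^ (1 / (2 * p)) * T ^ (1 / (2 * p)) := by
        gcongr
    _ = T := by
        rw [← ENNReal.rpow_add_of_nonneg _ _ t1 t2,
          ← ENNReal.rpow_add_of_nonneg _ _ (by positivity) t2]
        have : 1 - 1 / p + 1 / (2 * p) + 1 / (2 * p) = 1 := by field_simp; ring
        rw [this, ENNReal.rpow_one]

lemma sup_bound {n : ℕ} (hn : 1 ≤ n) (hn7 : n ≤ 7) {Ω : Set (EuclideanSpace ℝ (Fin n))}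
    (hΩ : GoodDomain Ω) {f : ℝ → ℝ} (hf : HypH ⊤ f) {p : ℝ} (hp : 7 / 4 < p) {G : ENNReal}
    (hG : G ≠ ⊤) : ∃ M : ℝ, ∀ lam > 0, ∀ u, Solves Ω ⊤ lam f u →
      ∫⁻ z in Ω, (ENNReal.ofReal (lam * f (u z))) ^ p ≤ G → ∀ x ∈ Ω, u x ≤ M := by
  obtain ⟨C, hC, hpot⟩ := potential hn hn7 hΩ
  set s : ℝ := 2 * p / (2 * p - 1) with hs
  set b : ℝ := 5 * (n:ℝ) / 7 with hb
  have hn' : (0:ℝ) < n := by exact_mod_cast hn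
  have hs75 : s < 7 / 5 := by
    rw [hs, div_lt_div_iff₀ (by linarith) (by norm_num)]
    linarith
  have hβ : b * s < n := by
    rw [hb]; nlinarith
  obtain ⟨K, hK, hKint⟩ := kernel_int hn hΩ hβ
  refine ⟨(C * (C * (K * K + G * K + K * G))).toReal, ?_⟩
  intro lam hlam u hsol hGu x0 hx0
  have hvpos := sol_neg_lap_pos hΩ hf hlam hsol
  obtain ⟨hu, hr, he, hbd, hbd2⟩ := hsol
  have hu2 : ContDiff ℝ 2 u := contDiff_infty.mp hu 2
  have hL2 : ContDiff ℝ 2 (lap u) := contDiff_infty.mp (lap_contDiff hu) 2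
  set v : EuclideanSpace ℝ (Fin n) → ℝ := fun y => - lap u y with hv
  have hv2 : ContDiff ℝ 2 v := hL2.neg
  have hlv : ∀ y ∈ Ω, - lap v y = lam * f (u y) := by
    intro y hy
    rw [hv, lap_neg' hL2, neg_neg, he y hy]
  have hlvc : Continuous (lap v) := lap_continuous hv2
  have hvc : Continuous v := hv2.continuous
  set g : EuclideanSpace ℝ (Fin n) → ENNReal := fun z => ENNReal.ofReal (- lap v z) with hg
  have hgm : Measurable g := (ENNReal.continuous_ofReal.comp hlvc.neg).measurable
  have hgG : ∫⁻ z in Ω, g z ^ p ≤ G := by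
    refine le_trans (le_of_eq ?_) hGu
    apply setLIntegral_congr_fun hΩ.1.measurableSet
    intro z hz
    simp only [hg]
    rw [hlv z hz]
  set N : EuclideanSpace ℝ (Fin n) → EuclideanSpace ℝ (Fin n) → ENNReal :=
    fun y z => (ENNReal.ofReal ‖z - y‖) ^ (-b) with hN
  have hNm : Measurable (Function.uncurry N) := by
    apply Measurable.pow_const
    apply ENNReal.measurable_ofReal.comp
    exact (measurable_snd.sub measurable_fst).norm
  have hNm1 : ∀ y, Measurable (N y) := fun y => hNm.of_uncurry_left
  have hNs : ∀ y z, N y z ^ s = (ENNReal.ofReal ‖z - y‖) ^ (-(b * s)) := by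
    intro y z
    rw [hN, ← ENNReal.rpow_mul]; congr 1; ring
  have hKN : ∀ y ∈ Ω, ∫⁻ z in Ω, N y z ^ s ≤ K := by
    intro y hy
    simp_rw [hNs]
    exact hKint y hy
  have hKN' : ∀ z ∈ Ω, ∫⁻ y in Ω, N y z ^ s ≤ K := by
    intro z hz
    simp_rw [hNs, norm_sub_rev z]
    exact hKint z hz
  have h1 : ENNReal.ofReal (u x0) ≤ C * ∫⁻ y in Ω, N x0 y * ENNReal.ofReal (v y) :=
    hpot u hu2 hbd (fun x hx => (hvpos x hx).le) x0 hx0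
  have h2 : ∀ y ∈ Ω, ENNReal.ofReal (v y) ≤ C * ∫⁻ z in Ω, N y z * g z := by
    intro y hy
    refine hpot v hv2 ?_ ?_ y hy
    · intro x hx; simp [hv, hbd2 x hx]
    · intro x hx
      rw [hlv x hx]
      exact mul_nonneg hlam.le (f_pos hf (hr x hx).1).le
  have h3 : ∀ y ∈ Ω, N x0 y * ENNReal.ofReal (v y) ≤
      C * (N x0 y ^ s * K + (∫⁻ z in Ω, N y z ^ s * g z ^ p) + N x0 y ^ s * G) := by
    intro y hy
    have hYs : Measurable fun z => N y z ^ s := (hNm1 y).pow_const _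
    have hgp : Measurable fun z => g z ^ p := hgm.pow_const _
    have hm1 : Measurable fun z => N y z * g z := (hNm1 y).mul hgm
    have hm2 : Measurable fun z => N y z ^ s * g z ^ p := hYs.mul hgp
    calc N x0 y * ENNReal.ofReal (v y) ≤ N x0 y * (C * ∫⁻ z in Ω, N y z * g z) := by
          gcongr; exact h2 y hy
      _ = C * ∫⁻ z in Ω, N x0 y * N y z * g z := by
          rw [mul_left_comm, ← lintegral_const_mul _ hm1]
          simp_rw [mul_assoc]
      _ ≤ C * ∫⁻ z in Ω, (N x0 y ^ s * N y z ^ s + N y z ^ s * g z ^ p + N x0 y ^ s * g z ^ p) := by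
          gcongr with z
          exact young3 (by linarith) hs
      _ ≤ _ := by
          rw [lintegral_add_right _ (hgp.const_mul _), lintegral_add_right _ hm2,
            lintegral_const_mul _ hYs, lintegral_const_mul _ hgp]
          gcongr
          exact hKN y hy
  have hmid : ∫⁻ y in Ω, ∫⁻ z in Ω, N y z ^ s * g z ^ p ≤ G * K := by
    rw [lintegral_lintegral_swap]
    · calc ∫⁻ z in Ω, ∫⁻ y in Ω, N y z ^ s * g z ^ p ≤ ∫⁻ z in Ω, g z ^ p * K := by
            apply setLIntegral_mono' hΩ.1.measurableSet
            intro z hz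
            have hm : Measurable fun y => N y z ^ s := (hNm.of_uncurry_right).pow_const _
            rw [lintegral_mul_const _ hm, mul_comm]
            gcongr
            exact hKN' z hz
        _ ≤ G * K := by
            rw [lintegral_mul_const _ (hgm.pow_const _)]
            gcongr
    · exact ((hNm.pow_const _).mul ((hgm.comp measurable_snd).pow_const _)).aemeasurable
  have hXs : Measurable fun y => N x0 y ^ s := (hNm1 x0).pow_const _
  have h4 : ∫⁻ y in Ω, N x0 y * ENNReal.ofReal (v y) ≤ C * (K * K + G * K + K * G) := by
    calc _ ≤ ∫⁻ y in Ω, C * (N x0 y ^ s * K + (∫⁻ z in Ω, N y z ^ s * g z ^ p) + N x0 y ^ s * G) :=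
          setLIntegral_mono' hΩ.1.measurableSet h3
      _ ≤ _ := by
          rw [lintegral_const_mul' _ _ hC, lintegral_add_right _ (hXs.mul_const _),
            lintegral_add_left (hXs.mul_const _), lintegral_mul_const _ hXs,
            lintegral_mul_const _ hXs]
          gcongr
          · exact hKN x0 hx0
          · exact hKN x0 hx0
  have h5 : ENNReal.ofReal (u x0) ≤ C * (C * (K * K + G * K + K * G)) :=
    h1.trans (by gcongr)
  refine (ENNReal.ofReal_le_iff_le_toReal ?_).mp h5
  finiteness

lemma lint_bound {n : ℕ} {Ω : Set (EuclideanSpace ℝ (Fin n))} (hΩ : GoodDomain Ω) {f : ℝ → ℝ}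
    (hf : HypH ⊤ f) {lam lamstar : ℝ} (hlam : 0 < lam) (hle : lam ≤ lamstar)
    {u : EuclideanSpace ℝ (Fin n) → ℝ} (hs : Solves Ω ⊤ lam f u) {p B : ℝ} (hp : 0 < p)
    (hi : IntegrableOn (fun x => f (u x) ^ p) Ω) (hB : ∫ x in Ω, f (u x) ^ p ≤ B) :
    ∫⁻ z in Ω, (ENNReal.ofReal (lam * f (u z))) ^ p ≤
      ENNReal.ofReal (lamstar ^ p) * ENNReal.ofReal B := by
  have hnn : ∀ x ∈ Ω, 0 ≤ f (u x) := fun x hx => (f_pos hf (hs.2.1 x hx).1).le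
  calc ∫⁻ z in Ω, (ENNReal.ofReal (lam * f (u z))) ^ p
      ≤ ∫⁻ z in Ω, ENNReal.ofReal (lamstar ^ p) * ENNReal.ofReal (f (u z) ^ p) := by
        apply setLIntegral_mono' hΩ.1.measurableSet
        intro z hz
        have h0 := hnn z hz
        have hl : 0 < lamstar := by linarith
        rw [ENNReal.ofReal_rpow_of_nonneg (mul_nonneg hlam.le h0) hp.le,
          ← ENNReal.ofReal_mul (by positivity), ← Real.mul_rpow hl.le h0]
        apply ENNReal.ofReal_le_ofReal
        gcongr
    _ ≤ _ := by
        rw [lintegral_const_mul' _ _ ENNReal.ofReal_ne_top,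
          ← ofReal_integral_eq_lintegral_ofReal hi
          ((ae_restrict_iff' hΩ.1.measurableSet).mpr (ae_of_all _ fun x hx =>
            Real.rpow_nonneg (hnn x hx) _))]
        gcongr

/-- **Corollary 2.4.** For a regular nonlinearity `f` satisfying (H) with
`liminf_{t→∞} f(t)^{1+ε/4} f''(t)/f'(t)² > 0` for some `0 ≤ ε < 1`, and `n ≤ 7`:
any sequence of semistable solutions satisfies `sup_m ‖f(u_m)‖_{L^{2−ε/4}(Ω)} < ∞`, and
the extremal solution `u*` is bounded. -/
theorem statement12 {n : ℕ} (hn : n ≤ 7) (Ω : Set (EuclideanSpace ℝ (Fin n)))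
    (hΩ : GoodDomain Ω) (f : ℝ → ℝ) (hf : HypH ⊤ f)
    (ε : ℝ) (hε0 : 0 ≤ ε) (hε1 : ε < 1)
    (hliminf : 0 < Filter.liminf
      (fun t => f t ^ (1 + ε / 4) * deriv (deriv f) t / (deriv f t) ^ 2) Filter.atTop)
    (lam : ℕ → ℝ) (hlam : ∀ m, 0 < lam m)
    (u : ℕ → EuclideanSpace ℝ (Fin n) → ℝ)
    (hsol : ∀ m, Solves Ω ⊤ (lam m) f (u m))
    (hsemi : ∀ m, Semistable Ω (lam m) f (u m))
    (lamstar : ℝ) (hls : 0 < lamstar)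
    (uf : ℝ → EuclideanSpace ℝ (Fin n) → ℝ)
    (hsolf : ∀ l ∈ Ioo (0:ℝ) lamstar, Solves Ω ⊤ l f (uf l))
    (hminf : ∀ l ∈ Ioo (0:ℝ) lamstar, ∀ v, Solves Ω ⊤ l f v → ∀ x ∈ Ω, uf l x ≤ v x)
    (hsemif : ∀ l ∈ Ioo (0:ℝ) lamstar, Semistable Ω l f (uf l))
    (ustar : EuclideanSpace ℝ (Fin n) → ℝ)
    (hlim : ∀ x ∈ Ω, Filter.Tendsto (fun l => uf l x) (nhdsWithin lamstar (Set.Iio lamstar))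
      (nhds (ustar x))) :
    (∃ C : ℝ, ∀ m, ∫ x in Ω, f (u m x) ^ (2 - ε / 4) ≤ C) ∧
    (∃ C : ℝ, ∀ x ∈ Ω, ustar x ≤ C) := by
  have hn1 : 1 ≤ n := by
    by_contra h
    have h0 : n = 0 := by omega
    subst h0
    obtain ⟨x, hx⟩ := hΩ.2.2
    have h1 := (hsol 0).2.2.1 x hx
    have h2 := mul_pos (hlam 0) (f_pos hf ((hsol 0).2.1 x hx).1)
    rw [← h1] at h2
    simp [lap] at h2
  obtain ⟨c, C, hc, hC, hk⟩ := key_growth hf hε1 hliminf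
  have hp : 7 / 4 < 2 - ε / 4 := by linarith
  have hp0 : 0 < 2 - ε / 4 := by linarith
  refine ⟨⟨C / c * volume.real Ω, fun m =>
    (lp_bound hΩ hf (hlam m) (hsol m) (hsemi m) hc hp0 hk).2⟩, ?_⟩
  obtain ⟨M, hM⟩ := sup_bound hn1 hn hΩ hf hp
    (G := ENNReal.ofReal (lamstar ^ (2 - ε / 4)) * ENNReal.ofReal (C / c * volume.real Ω))
    (ENNReal.mul_ne_top ENNReal.ofReal_ne_top ENNReal.ofReal_ne_top)
  refine ⟨M, fun x hx => le_of_tendsto (hlim x hx) ?_⟩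
  filter_upwards [Ioo_mem_nhdsLT hls] with l hl
  have hb := lp_bound hΩ hf hl.1 (hsolf l hl) (hsemif l hl) hc hp0 hk
  exact hM l hl.1 (uf l) (hsolf l hl)
    (lint_bound hΩ hf hl.1 hl.2.le (hsolf l hl) hp0 hb.1 hb.2) x hx

end
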